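/- arXiv:1208.6220 — 3 statements merged into one kernel-verified Lean document; each statement's English description precedes it below -/
import Mathlib

section
/- The only rational number c such that c^4 + 2c^3 + c^2 + c is a square of a rational number is c = 0. -/
abbrev Eis : Type := QuadraticAlgebra ℤ (-1) (-1)

theorem Eis.norm_eq (x : Eis) : QuadraticAlgebra.norm x = x.re ^ 2 - x.re * x.im + x.im ^ 2 := by
  rw [QuadraticAlgebra.norm_def]; ring

theorem Eis.norm_nonneg (x : Eis) : 0 ≤ QuadraticAlgebra.norm x := by
  rw [Eis.norm_eq]; nlinarith [sq_nonneg (x.re - x.im), sq_nonneg x.re, sq_nonneg x.im]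

theorem Eis.norm_pos {x : Eis} (h : x ≠ 0) : 0 < QuadraticAlgebra.norm x := by
  rcases (Eis.norm_nonneg x).lt_or_eq with h1 | h1
  · exact h1
  · exfalso
    apply h
    rw [Eis.norm_eq] at h1
    have h2 : x.re = 0 := by
      nlinarith [sq_nonneg (x.re - x.im), sq_nonneg x.re, sq_nonneg x.im]
    have h3 : x.im = 0 := by
      nlinarith [sq_nonneg (x.re - x.im), sq_nonneg x.re, sq_nonneg x.im]
    ext <;> simp [h2, h3]

theorem round_exists (u n : ℤ) (hn : 0 < n) : ∃ q : ℤ, |2 * (u - q * n)| ≤ n := by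
  refine ⟨(2 * u + n) / (2 * n), ?_⟩
  have h1 := Int.mul_ediv_add_emod (2 * u + n) (2 * n)
  have h2 := Int.emod_nonneg (2 * u + n) (by lia : 2 * n ≠ 0)
  have h3 := Int.emod_lt_of_pos (2 * u + n) (by lia : 0 < 2 * n)
  rw [abs_le]
  constructor <;> nlinarith

theorem Eis.div_exists (x y : Eis) (hy : y ≠ 0) :
    ∃ q : Eis, QuadraticAlgebra.norm (x - y * q) < QuadraticAlgebra.norm y := by
  have hn := Eis.norm_pos hy
  obtain ⟨q1, h1⟩ := round_exists (x * star y).re (QuadraticAlgebra.norm y) hn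
  obtain ⟨q2, h2⟩ := round_exists (x * star y).im (QuadraticAlgebra.norm y) hn
  refine ⟨⟨q1, q2⟩, ?_⟩
  set n := QuadraticAlgebra.norm y with hndef
  set e := (x * star y).re - q1 * n with he
  set f := (x * star y).im - q2 * n with hf
  have key : QuadraticAlgebra.norm (x - y * ⟨q1, q2⟩) * n = e ^ 2 - e * f + f ^ 2 := by
    rw [he, hf, hndef]
    simp only [Eis.norm_eq, QuadraticAlgebra.re_mul, QuadraticAlgebra.im_mul,
      QuadraticAlgebra.re_sub, QuadraticAlgebra.im_sub, QuadraticAlgebra.re_star,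
      QuadraticAlgebra.im_star]
    ring
  rw [abs_le] at h1 h2
  have : e ^ 2 - e * f + f ^ 2 < n * n := by nlinarith
  rw [← key] at this
  exact lt_of_mul_lt_mul_right this hn.le

noncomputable instance Eis.instEuclid : EuclideanDomain Eis :=
  { (inferInstance : CommRing Eis), (inferInstance : Nontrivial Eis) with
    quotient := fun x y => open Classical in
      if h : y = 0 then 0 else Classical.choose (Eis.div_exists x y h)
    quotient_zero := fun x => by simp
    remainder := fun x y => open Classical in
      x - y * (if h : y = 0 then 0 else Classical.choose (Eis.div_exists x y h))
    quotient_mul_add_remainder_eq := fun x y => by ring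
    r := fun x y => (QuadraticAlgebra.norm x).toNat < (QuadraticAlgebra.norm y).toNat
    r_wellFounded := (measure fun x : Eis => (QuadraticAlgebra.norm x).toNat).wf
    remainder_lt := fun x y hy => by
      have := Classical.choose_spec (Eis.div_exists x y hy)
      have h2 := Eis.norm_pos hy
      simp only [dif_neg hy]
      lia
    mul_left_not_lt := fun x y hy => by
      have h1 := Eis.norm_pos hy
      have h2 := Eis.norm_nonneg x
      rw [map_mul]
      have : QuadraticAlgebra.norm x ≤ QuadraticAlgebra.norm x * QuadraticAlgebra.norm y := by
        nlinarith
      lia }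

theorem Eis.unit_cases (u : Eis) (hu : IsUnit u) :
    (u.re = 1 ∧ u.im = 0) ∨ (u.re = -1 ∧ u.im = 0) ∨ (u.re = 0 ∧ u.im = 1) ∨
    (u.re = 0 ∧ u.im = -1) ∨ (u.re = 1 ∧ u.im = 1) ∨ (u.re = -1 ∧ u.im = -1) := by
  have h := QuadraticAlgebra.isUnit_iff_norm_isUnit.1 hu
  have h1 : QuadraticAlgebra.norm u = 1 := by
    rcases Int.isUnit_iff.1 h with h | h
    · exact h
    · have := Eis.norm_nonneg u
      lia
  rw [Eis.norm_eq] at h1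
  generalize u.re = a at *
  generalize u.im = b at *
  have ha : a ≤ 1 := by nlinarith [sq_nonneg (2 * b - a)]
  have ha' : -1 ≤ a := by nlinarith [sq_nonneg (2 * b - a)]
  have hb : b ≤ 1 := by nlinarith [sq_nonneg (2 * a - b)]
  have hb' : -1 ≤ b := by nlinarith [sq_nonneg (2 * a - b)]
  interval_cases a <;> interval_cases b <;> simp_all

theorem cube_lemma (r j n : ℤ) (hc : IsCoprime r j) (h3 : ¬ (3 : ℤ) ∣ r)
    (h : r ^ 2 - 3 * r * j + 9 * j ^ 2 = n ^ 3) :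
    ∃ a b : ℤ, r = a ^ 3 + b ^ 3 - 3 * a * b ^ 2 ∧ j = a * b * (a - b) := by
  let M : Eis := ⟨r, 3 * j⟩
  let M' : Eis := ⟨r - 3 * j, - (3 * j)⟩
  have hMM : M * M' = ((n : ℤ) : Eis) ^ 3 := by
    have : ((n : ℤ) : Eis) ^ 3 = ((n ^ 3 : ℤ) : Eis) := by push_cast; rfl
    rw [this, ← h]
    ext
    · simp only [M, M', QuadraticAlgebra.re_mul, QuadraticAlgebra.im_mul, QuadraticAlgebra.re_sub, QuadraticAlgebra.im_sub, QuadraticAlgebra.re_intCast, QuadraticAlgebra.im_intCast, Int.cast_id]; ring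
    · simp only [M, M', QuadraticAlgebra.re_mul, QuadraticAlgebra.im_mul, QuadraticAlgebra.re_sub, QuadraticAlgebra.im_sub, QuadraticAlgebra.re_intCast, QuadraticAlgebra.im_intCast, Int.cast_id]; ring
  have hcop : IsCoprime M M' := by
    -- some multiple combination gives 9j, 3r and norm
    have h3p : Prime (3 : ℤ) := Int.prime_three
    have hN3 : IsCoprime (r ^ 2 - 3 * r * j + 9 * j ^ 2) 9 := by
      have h3r : IsCoprime (3 : ℤ) (r ^ 2 - 3 * r * j + 9 * j ^ 2) := by
        rw [h3p.coprime_iff_not_dvd]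
        intro hd
        have : (3 : ℤ) ∣ r ^ 2 := by
          have e : r ^ 2 = (r ^ 2 - 3 * r * j + 9 * j ^ 2) + 3 * (r * j - 3 * j ^ 2) := by ring
          rw [e]; exact dvd_add hd (dvd_mul_right _ _)
        exact h3 (h3p.dvd_of_dvd_pow this)
      have h9 := h3r.symm.pow_right (n := 2)
      rwa [show (3 : ℤ) ^ 2 = 9 by norm_num] at h9
    obtain ⟨s, t, hst⟩ := hN3
    obtain ⟨p, q, hpq⟩ := hc
    -- 1 = s N + t 9 (p r + q j)
    have e1 : (⟨1, 2⟩ : Eis) * (M' - M) = ((9 * j : ℤ) : Eis) := by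
      ext <;> simp only [M, M', QuadraticAlgebra.re_mul, QuadraticAlgebra.im_mul, QuadraticAlgebra.re_sub, QuadraticAlgebra.im_sub, QuadraticAlgebra.re_intCast, QuadraticAlgebra.im_intCast, Int.cast_id] <;> ring
    have e2 : (⟨1, 2⟩ : Eis) * ((⟨-1, -1⟩ : Eis) * M - (⟨0, 1⟩ : Eis) * M') = ((3 * r : ℤ) : Eis) := by
      ext <;> simp only [M, M', QuadraticAlgebra.re_mul, QuadraticAlgebra.im_mul, QuadraticAlgebra.re_sub, QuadraticAlgebra.im_sub, QuadraticAlgebra.re_intCast, QuadraticAlgebra.im_intCast, Int.cast_id] <;> ring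
    have e3 : M * M' = ((r ^ 2 - 3 * r * j + 9 * j ^ 2 : ℤ) : Eis) := by
      rw [hMM, h]; push_cast; rfl
    have e4 : ((s * (r ^ 2 - 3 * r * j + 9 * j ^ 2) + t * (3 * p * (3 * r) + q * (9 * j)) : ℤ) : Eis) = 1 := by
      have : s * (r ^ 2 - 3 * r * j + 9 * j ^ 2) + t * (3 * p * (3 * r) + q * (9 * j)) = 1 := by
        linear_combination hst + 9 * t * hpq
      rw [this]; simp
    have e5 : (s : Eis) * (M * M') + t * (3 * p * ((⟨1, 2⟩ : Eis) * ((⟨-1, -1⟩ : Eis) * M - (⟨0, 1⟩ : Eis) * M')) + q * ((⟨1, 2⟩ : Eis) * (M' - M))) = 1 := by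
      rw [e1, e2, e3, ← e4]; push_cast; rfl
    refine ⟨s * M' + t * (3 * p * ((⟨1, 2⟩ : Eis) * (⟨-1, -1⟩ : Eis)) - q * (⟨1, 2⟩ : Eis)), t * (- (3 * p * ((⟨1, 2⟩ : Eis) * (⟨0, 1⟩ : Eis))) + q * (⟨1, 2⟩ : Eis)), ?_⟩
    rw [← e5]; ring
  obtain ⟨d, u, hu⟩ := exists_associated_pow_of_mul_eq_pow' hcop hMM
  have hre := congrArg QuadraticAlgebra.re hu
  have him := congrArg QuadraticAlgebra.im hu
  have hd3 : d ^ 3 = d * d * d := by ring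
  rw [hd3] at hre him
  simp only [QuadraticAlgebra.re_mul, QuadraticAlgebra.im_mul, M] at hre him
  have h3' : ∀ k : ℤ, r ≠ 3 * k := fun k hk => h3 ⟨k, hk⟩
  generalize d.re = a at *
  generalize d.im = b at *
  rcases Eis.unit_cases u u.isUnit with ⟨h1, h2⟩ | ⟨h1, h2⟩ | ⟨h1, h2⟩ | ⟨h1, h2⟩ | ⟨h1, h2⟩ | ⟨h1, h2⟩ <;>
    rw [h1, h2] at hre him
  · exact ⟨a, b, by linear_combination -hre, by linarith⟩
  · exact ⟨-a, -b, by linear_combination -hre, by linarith⟩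
  all_goals exfalso
  · exact h3' (- (a * b * (a - b))) (by linarith)
  · exact h3' ((a * b * (a - b))) (by linarith)
  · exact h3' (j - (a * b * (a - b))) (by linarith)
  · exact h3' (j + (a * b * (a - b))) (by linarith)

theorem coprime_of_primes {x y : ℤ} (h : ∀ p : ℤ, Prime p → p ∣ x → p ∣ y → False) :
    IsCoprime x y := by
  apply isCoprime_of_prime_dvd
  · rintro ⟨rfl, rfl⟩
    exact h 2 Int.prime_two (dvd_zero _) (dvd_zero _)
  · intro p hp h1 h2
    exact h p hp h1 h2

theorem prime_dvd_of_sq_dvd {p z : ℤ} (hp : Prime p) (h : p ^ 2 ∣ 46 * z ^ 3) : p ∣ z := by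
  by_contra hz
  have hcop : IsCoprime (p ^ 2) (z ^ 3) := ((hp.coprime_iff_not_dvd).2 hz).pow
  have h46 : p ^ 2 ∣ 46 := hcop.dvd_of_dvd_mul_right h
  have hsq : Squarefree (46 : ℤ) := by
    rw [← Int.squarefree_natAbs]
    decide +kernel
  have := hsq p (by rw [← sq]; exact h46)
  exact hp.not_isUnit this

theorem inert23 (r j : ℤ) (h : (23 : ℤ) ∣ r ^ 2 - 3 * r * j + 9 * j ^ 2) :
    (23 : ℤ) ∣ r ∧ (23 : ℤ) ∣ j := by
  have key : ∀ x y : ZMod 23, x ^ 2 - 3 * x * y + 9 * y ^ 2 = 0 → x = 0 ∧ y = 0 := by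
    decide +kernel
  have h1 : (((r ^ 2 - 3 * r * j + 9 * j ^ 2 : ℤ)) : ZMod 23) = 0 :=
    (ZMod.intCast_zmod_eq_zero_iff_dvd _ 23).2 h
  push_cast at h1
  obtain ⟨h2, h3⟩ := key _ _ h1
  exact ⟨(ZMod.intCast_zmod_eq_zero_iff_dvd _ 23).1 h2,
    (ZMod.intCast_zmod_eq_zero_iff_dvd _ 23).1 h3⟩

theorem main_factor (r j z T : ℤ) (h3 : ¬ (3 : ℤ) ∣ r) (hodd : ¬ (2 : ℤ) ∣ r)
    (hT : T = 3 * j - 2 * r + 6 * z ∨ T = 2 * z - j)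
    (heq : T * (r ^ 2 - 3 * r * j + 9 * j ^ 2) = -46 * z ^ 3)
    (hg : ∀ p : ℤ, Prime p → p ∣ r → p ∣ j → p ∣ z → False) :
    ∃ a b g : ℤ, r = a ^ 3 + b ^ 3 - 3 * a * b ^ 2 ∧ j = a * b * (a - b) ∧
      T = -46 * g ^ 3 ∧ z = g * (a ^ 2 - a * b + b ^ 2) := by
  have hrj : IsCoprime r j := by
    apply coprime_of_primes
    intro p hp h1 h2
    apply hg p hp h1 h2
    apply prime_dvd_of_sq_dvd hp
    obtain ⟨r', rfl⟩ := h1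
    obtain ⟨j', rfl⟩ := h2
    exact ⟨- (T * (r' ^ 2 - 3 * r' * j' + 9 * j' ^ 2)), by linarith⟩
  set N := r ^ 2 - 3 * r * j + 9 * j ^ 2 with hN
  have hN3 : ∀ p : ℤ, Prime p → p ∣ N → p ∣ 3 → False := by
    intro p hp h1 h2
    have : p ∣ r ^ 2 := by
      have e : r ^ 2 = N + 3 * (r * j - 3 * j ^ 2) := by rw [hN]; ring
      rw [e]; exact dvd_add h1 (h2.mul_right _)
    have h4 := hp.dvd_of_dvd_pow this
    have h5 : Associated p 3 := hp.associated_of_dvd Int.prime_three h2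
    exact h3 (h5.symm.dvd.trans h4)
  have hN2 : ¬ (2 : ℤ) ∣ N := by
    intro hd
    have h2 : Odd r := by rwa [← Int.not_even_iff_odd, even_iff_two_dvd]
    rw [← even_iff_two_dvd] at hd
    rcases Int.even_or_odd j with hj | hj <;> simp [hN, h2, hj, Int.even_add, Int.even_sub, Int.even_mul, Int.even_pow, parity_simps] at hd
    all_goals grind
  have hN23 : ¬ (23 : ℤ) ∣ N := by
    intro hd
    obtain ⟨h1, h2⟩ := inert23 r j hd
    have := hrj.isUnit_of_dvd' h1 h2
    rw [Int.isUnit_iff] at this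
    lia
  have hp23 : Prime (23 : ℤ) := by
    rw [Int.prime_iff_natAbs_prime]; norm_num
  have hcop46 : IsCoprime (46 : ℤ) N := by
    have := ((Int.prime_two.coprime_iff_not_dvd).2 hN2).mul_left
      ((hp23.coprime_iff_not_dvd).2 hN23)
    norm_num at this; exact this
  have hTN : IsCoprime T N := by
    apply coprime_of_primes
    intro p hp h1 h2
    have hz : p ∣ z := by
      apply prime_dvd_of_sq_dvd hp
      rw [sq, ← dvd_neg]
      have := mul_dvd_mul h1 h2
      rw [heq] at this
      convert this using 1; ring
    have hrj' : p ∣ r ∧ p ∣ j := by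
      rcases hT with hT | hT
      · have hq : p ∣ 3 * j - 2 * r := by
          have e : 3 * j - 2 * r = T - 6 * z := by rw [hT]; ring
          rw [e]; exact dvd_sub h1 (hz.mul_left _)
        have h5 : p ∣ 3 * r ^ 2 := by
          have e : 3 * r ^ 2 = N - (3 * j - 2 * r) * (3 * j + r) := by rw [hN]; ring
          rw [e]; exact dvd_sub h2 (hq.mul_right _)
        have h6 : p ∣ r := by
          rcases hp.dvd_or_dvd h5 with h | h
          · exact (hN3 p hp h2 h).elim
          · exact hp.dvd_of_dvd_pow h
        have h7 : p ∣ 3 * j := by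
          have e : 3 * j = (3 * j - 2 * r) + 2 * r := by ring
          rw [e]; exact dvd_add hq (h6.mul_left _)
        refine ⟨h6, ?_⟩
        rcases hp.dvd_or_dvd h7 with h | h
        · exact (hN3 p hp h2 h).elim
        · exact h
      · have h6 : p ∣ j := by
          have e : j = 2 * z - T := by rw [hT]; ring
          rw [e]; exact dvd_sub (hz.mul_left _) h1
        refine ⟨?_, h6⟩
        have : p ∣ r ^ 2 := by
          have e : r ^ 2 = N + j * (3 * r - 9 * j) := by rw [hN]; ring
          rw [e]; exact dvd_add h2 (h6.mul_right _)
        exact hp.dvd_of_dvd_pow this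
    exact hg p hp hrj'.1 hrj'.2 hz
  have hdT : (46 : ℤ) ∣ T := by
    apply hcop46.dvd_of_dvd_mul_right
    rw [heq]; exact ⟨- z ^ 3, by ring⟩
  obtain ⟨t, ht⟩ := hdT
  have htN : (-t) * N = z ^ 3 := by
    rw [ht] at heq
    linarith
  have hcop : IsCoprime (-t) N := by
    apply IsCoprime.neg_left
    rw [ht] at hTN
    exact hTN.of_mul_left_right
  obtain ⟨⟨g, hg1⟩, ⟨n, hn⟩⟩ := Int.eq_pow_of_mul_eq_pow_odd hcop (by decide) htN
  obtain ⟨a, b, hr, hj⟩ := cube_lemma r j n hrj h3 (by rw [← hn])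
  refine ⟨a, b, g, hr, hj, by linarith, ?_⟩
  have : z ^ 3 = (g * (a ^ 2 - a * b + b ^ 2)) ^ 3 := by
    rw [← htN, hg1, hN, hr, hj]; ring
  exact (Odd.strictMono_pow (R := ℤ) (n := 3) (by decide)).injective this

/-- Descent step: from a solution of X^3+Y^3+2Z^3=2XYZ to a smaller triple. -/
theorem descent_step (X Y Z : ℤ) (hX : ¬ (2 : ℤ) ∣ X) (hY : ¬ (2 : ℤ) ∣ Y)
    (hXY : IsCoprime X Y) (hZ : Z ≠ 0) (h : X ^ 3 + Y ^ 3 + 2 * Z ^ 3 = 2 * (X * Y * Z)) :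
    ∃ A B C g : ℤ, g ≠ 0 ∧ g.natAbs < Z.natAbs ∧ A + B + C = 2 * g ∧ A * B * C = 2 * g ^ 3 := by
  by_cases hZ3 : (3 : ℤ) ∣ Z
  · -- second case
    obtain ⟨ζ, rfl⟩ := hZ3
    have hS : (3 : ℤ) ∣ X + Y := by
      have : (3 : ℤ) ∣ (X + Y) ^ 3 :=
        ⟨X * Y * (X + Y) - 18 * ζ ^ 3 + 2 * X * Y * ζ, by linear_combination h⟩
      exact Int.prime_three.dvd_of_dvd_pow this
    obtain ⟨σ, hσ⟩ := hS
    have hXσ : X = 3 * σ - Y := by linarith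
    have hY3 : ¬ (3 : ℤ) ∣ Y := by
      intro hd
      have hd' : (3 : ℤ) ∣ X := by rw [hXσ]; exact dvd_sub (dvd_mul_right _ _) hd
      have := hXY.isUnit_of_dvd' hd' hd
      rw [Int.isUnit_iff] at this
      lia
    have hY2 : ¬ (3 : ℤ) ∣ Y ^ 2 := fun hd => hY3 (Int.prime_three.dvd_of_dvd_pow hd)
    subst hXσ
    have hζ : (3 : ℤ) ∣ ζ := by
      have : (3 : ℤ) ∣ Y ^ 2 * (2 * ζ) := by
        refine ⟨-(3 * σ ^ 3 - 3 * σ * Y * σ + σ * Y ^ 2 + 6 * ζ ^ 3 - 2 * σ * Y * ζ), ?_⟩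
        linarith
      rcases Int.prime_three.dvd_or_dvd this with h | h
      · exact (hY2 h).elim
      · lia
    obtain ⟨η, rfl⟩ := hζ
    have hτ : (3 : ℤ) ∣ σ + 2 * η := by
      have : (3 : ℤ) ∣ Y ^ 2 * (σ + 2 * η) := by
        refine ⟨-(σ ^ 3 - σ ^ 2 * Y + 54 * η ^ 3 - 2 * σ * Y * η), ?_⟩
        linarith
      rcases Int.prime_three.dvd_or_dvd this with h | h
      · exact (hY2 h).elim
      · exact h
    obtain ⟨τ, hτ⟩ := hτ
    have hστ : σ = 3 * τ - 2 * η := by linarith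
    subst hστ
    obtain ⟨a, b, g, hr, hj, hT, hz⟩ := main_factor (Y + 6 * η - 6 * τ) (2 * η - τ) η τ
      (by intro hd; apply hY3; lia) (by intro hd; apply hY; lia) (Or.inr (by ring))
      (by linarith)
      (by
        intro p hp h1 h2 h3
        have h4 : p ∣ τ := by
          have e : τ = 2 * η - (2 * η - τ) := by ring
          rw [e]; exact dvd_sub (h3.mul_left _) h2
        have h5 : p ∣ Y := by
          have e : Y = (Y + 6 * η - 6 * τ) - 6 * η + 6 * τ := by ring
          rw [e]; exact dvd_add (dvd_sub h1 (h3.mul_left _)) (h4.mul_left _)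
        have h6 : p ∣ 3 * (3 * τ - 2 * η) - Y :=
          dvd_sub ((dvd_sub (h4.mul_left _) (h3.mul_left _)).mul_left _) h5
        exact hp.not_isUnit (hXY.isUnit_of_dvd' h6 h5))
    have hg0 : g ≠ 0 := by
      rintro rfl
      apply hZ; rw [hz]; ring
    have hη0 : η ≠ 0 := by
      rintro rfl
      exact hZ (by ring)
    have hle : g.natAbs ≤ η.natAbs := Nat.le_of_dvd (Int.natAbs_pos.2 hη0)
      (Int.natAbs_dvd_natAbs.2 ⟨_, hz⟩)
    refine ⟨b - 2 * g, a - b - 2 * g, -a - 2 * g, -3 * g, by lia, by lia, by ring, ?_⟩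
    have e : 2 * (g * (a ^ 2 - a * b + b ^ 2)) - a * b * (a - b) = -46 * g ^ 3 := by
      rw [← hz, ← hj, ← hT]; ring
    linear_combination e
  · -- first case
    obtain ⟨a, b, g, hr, hj, hT, hz⟩ := main_factor (2 * Z - 3 * Y) (X - Y) Z
      (3 * X + 3 * Y + 2 * Z)
      (by intro hd; apply hZ3; lia) (by intro hd; apply hY; lia) (Or.inl (by ring))
      (by linear_combination 27 * h)
      (by
        intro p hp h1 h2 h3
        have h4 : p ∣ 3 * Y := by
          have e : 3 * Y = 2 * Z - (2 * Z - 3 * Y) := by ring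
          rw [e]; exact dvd_sub (h3.mul_left _) h1
        rcases hp.dvd_or_dvd h4 with h5 | h5
        · have h6 : Associated p 3 := hp.associated_of_dvd Int.prime_three h5
          exact hZ3 (h6.symm.dvd.trans h3)
        · have h6 : p ∣ X := by
            have e : X = (X - Y) + Y := by ring
            rw [e]; exact dvd_add h2 h5
          exact hp.not_isUnit (hXY.isUnit_of_dvd' h6 h5))
    have hg0 : g ≠ 0 := by
      rintro rfl
      apply hZ; rw [hz]; ring
    have hXneY : X ≠ Y := by
      rintro rfl
      have h1 : X ^ 3 + Z ^ 3 = X * X * Z := by linarith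
      have hXo : Odd X := by rwa [← Int.not_even_iff_odd, even_iff_two_dvd]
      have h2 : Even (X ^ 3 + Z ^ 3) ↔ Even (X * X * Z) := by rw [h1]
      simp only [Int.even_add, Int.even_mul, Int.even_pow] at h2
      rw [← Int.not_even_iff_odd] at hXo
      grind
    have hlt : g.natAbs < Z.natAbs := by
      have hN : 2 ≤ a ^ 2 - a * b + b ^ 2 := by
        have hj0 : a * b * (a - b) ≠ 0 := by rw [← hj]; exact sub_ne_zero.2 hXneY
        have ha : a ≠ 0 := by rintro rfl; simp at hj0
        have hb : b ≠ 0 := by rintro rfl; simp at hj0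
        have hab : a - b ≠ 0 := by intro h0; simp [h0] at hj0
        have h1 : 1 ≤ a ^ 2 := by have := sq_pos_of_ne_zero ha; lia
        have h2 : 1 ≤ b ^ 2 := by have := sq_pos_of_ne_zero hb; lia
        have h3 : 1 ≤ (a - b) ^ 2 := by have := sq_pos_of_ne_zero hab; lia
        nlinarith
      have h1 : 2 ≤ (a ^ 2 - a * b + b ^ 2).natAbs := by lia
      have h2 : 0 < g.natAbs := Int.natAbs_pos.2 hg0
      have h3 : Z.natAbs = g.natAbs * (a ^ 2 - a * b + b ^ 2).natAbs := by
        rw [hz, Int.natAbs_mul]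
      rw [h3]
      nlinarith
    have h3 : (3 : ℤ) ∣ a + b + g := by
      have : (3 : ℤ) ∣ (a + b + g) ^ 3 := by
        have e : 3 * (a * b * (a - b)) - 2 * (a ^ 3 + b ^ 3 - 3 * a * b ^ 2)
            + 6 * (g * (a ^ 2 - a * b + b ^ 2)) = -46 * g ^ 3 := by
          rw [← hz, ← hj, ← hT, ← hr]; ring
        have e2 : (a + b + g) ^ 3 = 3 * ((a + b) ^ 2 * g + (a + b) * g ^ 2 + a ^ 2 * b + a * b ^ 2
            - 15 * g ^ 3 - (a * b * (a - b)) - 2 * (g * (a ^ 2 - a * b + b ^ 2))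
            + a ^ 3 + b ^ 3 - 2 * a * b ^ 2) := by
          linear_combination e
        exact ⟨_, e2⟩
      exact Int.prime_three.dvd_of_dvd_pow this
    obtain ⟨k, hk⟩ := h3
    have e : 3 * (a * b * (a - b)) - 2 * (a ^ 3 + b ^ 3 - 3 * a * b ^ 2)
        + 6 * (g * (a ^ 2 - a * b + b ^ 2)) = -46 * g ^ 3 := by
      rw [← hz, ← hj, ← hT, ← hr]; ring
    have hgk : g = 3 * k - a - b := by linarith
    refine ⟨2 * k - b, 2 * k - a - b, 2 * k - a, g, hg0, hlt, by linarith, ?_⟩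
    rw [hgk] at e ⊢
    linarith

theorem no_triple (n : ℕ) : ∀ A B C g : ℤ, g.natAbs = n → g ≠ 0 → A + B + C = 2 * g →
    A * B * C = 2 * g ^ 3 → False := by
  induction n using Nat.strong_induction_on with
  | _ n ih =>
  intro A B C g hn hg hs hp
  -- symmetric helper: no prime divides two
  have hcop : ∀ A B C : ℤ, A + B + C = 2 * g → A * B * C = 2 * g ^ 3 → IsCoprime A B := by
    intro A B C hs hp
    apply coprime_of_primes
    intro p hpp h1 h2
    obtain ⟨A', rfl⟩ := h1
    obtain ⟨B', rfl⟩ := h2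
    have h3 : p ∣ g := by
      apply prime_dvd_of_sq_dvd hpp
      exact ⟨23 * (A' * B' * C), by linear_combination -23 * hp⟩
    obtain ⟨g', rfl⟩ := h3
    have hC : C = p * (2 * g' - A' - B') := by linear_combination hs
    subst hC
    have hp0 := hpp.ne_zero
    have hg' : g' ≠ 0 := by rintro rfl; simp at hg
    refine ih g'.natAbs ?_ A' B' (2 * g' - A' - B') g' rfl hg' (by ring) ?_
    · rw [← hn, Int.natAbs_mul]
      have h4 : 2 ≤ p.natAbs := (Int.prime_iff_natAbs_prime.1 hpp).two_le
      have h5 : 0 < g'.natAbs := Int.natAbs_pos.2 hg'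
      nlinarith
    · have : p ^ 3 * (A' * B' * (2 * g' - A' - B')) = p ^ 3 * (2 * g' ^ 3) := by
        linear_combination hp
      exact mul_left_cancel₀ (pow_ne_zero 3 hp0) this
  have key : ∀ A B C : ℤ, A + B + C = 2 * g → A * B * C = 2 * g ^ 3 → (2 : ℤ) ∣ C → False := by
    intro A B C hs hp h2
    have hAB := hcop A B C hs hp
    have hAC := hcop A C B (by linarith) (by linarith)
    have hBC := hcop B C A (by linarith) (by linarith)
    obtain ⟨D, rfl⟩ := h2
    have hpr : A * B * D = g ^ 3 := by linarith
    have hA2 : ¬ (2 : ℤ) ∣ A := fun hd => Int.prime_two.not_isUnit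
      (hAC.isUnit_of_dvd' hd (dvd_mul_right _ _))
    have hB2 : ¬ (2 : ℤ) ∣ B := fun hd => Int.prime_two.not_isUnit
      (hBC.isUnit_of_dvd' hd (dvd_mul_right _ _))
    have hAD := hAC.of_mul_right_right
    have hBD := hBC.of_mul_right_right
    obtain ⟨⟨W, hW⟩, ⟨Z, hZ⟩⟩ := Int.eq_pow_of_mul_eq_pow_odd (hAD.mul_left hBD)
      (by decide : Odd 3) hpr
    obtain ⟨⟨X, hX⟩, ⟨Y, hY⟩⟩ := Int.eq_pow_of_mul_eq_pow_odd hAB (by decide : Odd 3) hW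
    subst hX hY hZ
    have hg3 : X * Y * Z = g := by
      apply (Odd.strictMono_pow (R := ℤ) (n := 3) (by decide)).injective
      show (X * Y * Z) ^ 3 = g ^ 3
      rw [← hpr]; ring
    have hZ0 : Z ≠ 0 := by rintro rfl; apply hg; rw [← hg3]; ring
    have hX0 : X ≠ 0 := by rintro rfl; apply hg; rw [← hg3]; ring
    have hY0 : Y ≠ 0 := by rintro rfl; apply hg; rw [← hg3]; ring
    obtain ⟨A', B', C', g', h1, h2, h3, h4⟩ := descent_step X Y Z
      (fun hd => hA2 (dvd_pow hd (by norm_num))) (fun hd => hB2 (dvd_pow hd (by norm_num)))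
      ((IsCoprime.pow_iff (by norm_num) (by norm_num)).1 hAB) hZ0 (by rw [hg3]; exact hs)
    refine ih g'.natAbs ?_ A' B' C' g' rfl h1 h3 h4
    have h5 : Z.natAbs ≤ g.natAbs := Nat.le_of_dvd (Int.natAbs_pos.2 hg)
      (Int.natAbs_dvd_natAbs.2 ⟨X * Y, by rw [← hg3]; ring⟩)
    lia
  have h2 : (2 : ℤ) ∣ A * B * C := ⟨_, hp⟩
  rcases Int.prime_two.dvd_or_dvd h2 with h2 | h2
  · rcases Int.prime_two.dvd_or_dvd h2 with h2 | h2
    · exact key B C A (by linarith) (by linarith) h2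
    · exact key A C B (by linarith) (by linarith) h2
  · exact key A B C hs hp h2

theorem stmt_1 (c : ℚ) :
    (∃ y : ℚ, y ^ 2 = c ^ 4 + 2 * c ^ 3 + c ^ 2 + c) ↔ c = 0 := by
  constructor
  · rintro ⟨y, hy⟩
    by_contra hc
    set d : ℤ := (c.den : ℤ) with hd
    set e : ℤ := (y.den : ℤ) with he
    have hd0 : (d : ℚ) ≠ 0 := by rw [hd]; exact_mod_cast c.den_nz
    have he0 : (e : ℚ) ≠ 0 := by rw [he]; exact_mod_cast y.den_nz
    set m : ℤ := c.num
    set k : ℤ := y.num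
    have hcm : (m : ℚ) = c * d := by
      rw [hd]; exact_mod_cast (Rat.mul_den_eq_num c).symm
    have hyk : (k : ℚ) = y * e := by
      rw [he]; exact_mod_cast (Rat.mul_den_eq_num y).symm
    -- scale by d^2 e
    have hg0 : m * d * e ≠ 0 := by
      have : ((m * d * e : ℤ) : ℚ) ≠ 0 := by
        push_cast; rw [hcm]
        exact mul_ne_zero (mul_ne_zero (mul_ne_zero hc hd0) hd0) he0
      exact_mod_cast this
    refine no_triple _ (m * d * e + m ^ 2 * e - k * d ^ 2) (m * d * e + m ^ 2 * e + k * d ^ 2)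
      (-2 * m ^ 2 * e) (m * d * e) rfl hg0 (by ring) ?_
    have : (((m * d * e + m ^ 2 * e - k * d ^ 2) * (m * d * e + m ^ 2 * e + k * d ^ 2) *
      (-2 * m ^ 2 * e) : ℤ) : ℚ) = ((2 * (m * d * e) ^ 3 : ℤ) : ℚ) := by
      push_cast
      rw [hcm, hyk]
      linear_combination (2 * c ^ 2 * d ^ 6 * e ^ 3) * hy
    exact_mod_cast this
  · rintro rfl
    exact ⟨0, by norm_num⟩
end

section
/- The only integer solutions (x, y) of y^2 = x^3 - x + 1 are (x, y) ∈ {(0, ±1), (1, ±1), (-1, ±1), (3, ±5), (5, ±11), (56, ±419)}. -/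
set_option linter.unusedSimpArgs false
open NumberField in
theorem units_rel {K : Type*} [Field K] [NumberField K] (φ : K →+* ℝ) {R : Type*} [CommRing R]
    (f : R →+* 𝓞 K) (hf : Function.Injective f) (n : ℕ) (hn : Units.rank K < n)
    (u : Fin n → Rˣ) : ∃ c : Fin n → ℤ, (∃ i, Odd (c i)) ∧
      (((∏ i, u i ^ c i : Rˣ) : R) = 1 ∨ ((∏ i, u i ^ c i : Rˣ) : R) = -1) := by
  classical
  let g : Rˣ →* (𝓞 K)ˣ := _root_.Units.map f.toMonoidHom
  let v : Fin n → Additive (𝓞 K)ˣ := fun i => Additive.ofMul (g (u i))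
  have hdep : ¬ LinearIndependent ℤ v := by
    intro h
    have h1 := h.fintype_card_le_finrank
    rw [Units.finrank_eq, Fintype.card_fin] at h1
    omega
  rw [Fintype.not_linearIndependent_iff] at hdep
  obtain ⟨c, hc, i, hi⟩ := hdep
  obtain ⟨d, hd, hgcd⟩ := Finset.extract_gcd c (s := Finset.univ) ⟨i, Finset.mem_univ i⟩
  have hG : Finset.univ.gcd c ≠ 0 := by
    intro h
    rw [Finset.gcd_eq_zero_iff] at h
    exact hi (h i (Finset.mem_univ i))
  refine ⟨d, ?_, ?_⟩
  · by_contra hcon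
    push Not at hcon
    have : (2 : ℤ) ∣ Finset.univ.gcd d := Finset.dvd_gcd fun j _ => by
      have := Int.not_odd_iff_even.mp (hcon j)
      exact this.two_dvd
    rw [hgcd] at this
    omega
  · have hpow : g (∏ i, u i ^ d i) ^ (Finset.univ.gcd c) = 1 := by
      have h1 : Additive.ofMul (g (∏ i, u i ^ d i) ^ (Finset.univ.gcd c)) = ∑ i, c i • v i := by
        simp only [v, map_prod, map_zpow]
        rw [← Finset.prod_zpow, ofMul_prod]
        refine Finset.sum_congr rfl fun j hj => ?_
        rw [hd j hj, ← zpow_mul, mul_comm, ← ofMul_zpow]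
      rw [hc] at h1
      exact h1
    set U := ∏ i, u i ^ d i
    have hmem : IsOfFinOrder (g U) := isOfFinOrder_iff_zpow_eq_one.mpr ⟨_, hG, hpow⟩
    rw [isOfFinOrder_iff_pow_eq_one] at hmem
    obtain ⟨m, hm, h1⟩ := hmem
    have h2 : (φ (algebraMap (𝓞 K) K (f U))) ^ m = 1 := by
      have := congrArg (fun z : (𝓞 K)ˣ => φ (algebraMap (𝓞 K) K (z : 𝓞 K))) h1
      simpa [g] using this
    have inj : Function.Injective fun z : R => φ (algebraMap (𝓞 K) K (f z)) :=
      φ.injective.comp ((FaithfulSMul.algebraMap_injective (𝓞 K) K).comp hf)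
    have h3 := (pow_eq_one_iff_of_ne_zero hm.ne').mp h2
    rcases h3 with h3 | ⟨h3, -⟩
    · left; apply inj; simpa using h3
    · right; apply inj; simpa using h3

/-- The order `ℤ + ℤ ρ + ℤ w + ℤ ρ w` with `ρ ^ 2 = 2 w` and `w ^ 2 = 2 ρ w - 1`. -/
@[ext] structure Qr where
  a : ℤ
  b : ℤ
  c : ℤ
  d : ℤ

namespace Qr

instance : Zero Qr := ⟨⟨0, 0, 0, 0⟩⟩
instance : One Qr := ⟨⟨1, 0, 0, 0⟩⟩
instance : Add Qr := ⟨fun x y => ⟨x.a + y.a, x.b + y.b, x.c + y.c, x.d + y.d⟩⟩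
instance : Neg Qr := ⟨fun x => ⟨-x.a, -x.b, -x.c, -x.d⟩⟩
instance : Mul Qr := ⟨fun x y =>
  ⟨x.a * y.a - 2 * (x.b * y.d + x.d * y.b) - x.c * y.c - 4 * (x.c * y.d + x.d * y.c)
      - 16 * (x.d * y.d),
   x.a * y.b + x.b * y.a - (x.c * y.d + x.d * y.c) - 4 * (x.d * y.d),
   x.a * y.c + x.c * y.a + 2 * (x.b * y.b) - 2 * (x.d * y.d),
   x.a * y.d + x.d * y.a + (x.b * y.c + x.c * y.b) + 4 * (x.b * y.d + x.d * y.b)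
      + 2 * (x.c * y.c) + 8 * (x.c * y.d + x.d * y.c) + 32 * (x.d * y.d)⟩⟩

@[simp] theorem zero_a : (0 : Qr).a = 0 := rfl
@[simp] theorem zero_b : (0 : Qr).b = 0 := rfl
@[simp] theorem zero_c : (0 : Qr).c = 0 := rfl
@[simp] theorem zero_d : (0 : Qr).d = 0 := rfl
@[simp] theorem one_a : (1 : Qr).a = 1 := rfl
@[simp] theorem one_b : (1 : Qr).b = 0 := rfl
@[simp] theorem one_c : (1 : Qr).c = 0 := rfl
@[simp] theorem one_d : (1 : Qr).d = 0 := rfl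
@[simp] theorem add_a (x y : Qr) : (x + y).a = x.a + y.a := rfl
@[simp] theorem add_b (x y : Qr) : (x + y).b = x.b + y.b := rfl
@[simp] theorem add_c (x y : Qr) : (x + y).c = x.c + y.c := rfl
@[simp] theorem add_d (x y : Qr) : (x + y).d = x.d + y.d := rfl
@[simp] theorem neg_a (x : Qr) : (-x).a = -x.a := rfl
@[simp] theorem neg_b (x : Qr) : (-x).b = -x.b := rfl
@[simp] theorem neg_c (x : Qr) : (-x).c = -x.c := rfl
@[simp] theorem neg_d (x : Qr) : (-x).d = -x.d := rfl
@[simp] theorem mul_a (x y : Qr) : (x * y).a = x.a * y.a - 2 * (x.b * y.d + x.d * y.b)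
    - x.c * y.c - 4 * (x.c * y.d + x.d * y.c) - 16 * (x.d * y.d) := rfl
@[simp] theorem mul_b (x y : Qr) : (x * y).b =
    x.a * y.b + x.b * y.a - (x.c * y.d + x.d * y.c) - 4 * (x.d * y.d) := rfl
@[simp] theorem mul_c (x y : Qr) : (x * y).c =
    x.a * y.c + x.c * y.a + 2 * (x.b * y.b) - 2 * (x.d * y.d) := rfl
@[simp] theorem mul_d (x y : Qr) : (x * y).d =
    x.a * y.d + x.d * y.a + (x.b * y.c + x.c * y.b) + 4 * (x.b * y.d + x.d * y.b)
      + 2 * (x.c * y.c) + 8 * (x.c * y.d + x.d * y.c) + 32 * (x.d * y.d) := rfl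

instance : CommRing Qr where
  add_assoc x y z := by ext <;> simp <;> ring
  zero_add x := by ext <;> simp
  add_zero x := by ext <;> simp
  add_comm x y := by ext <;> simp <;> ring
  neg_add_cancel x := by ext <;> simp
  mul_assoc x y z := by ext <;> simp <;> ring
  one_mul x := by ext <;> simp
  mul_one x := by ext <;> simp
  mul_comm x y := by ext <;> simp <;> ring
  left_distrib x y z := by ext <;> simp <;> ring
  right_distrib x y z := by ext <;> simp <;> ring
  zero_mul x := by ext <;> simp
  mul_zero x := by ext <;> simp
  nsmul := nsmulRec
  zsmul := zsmulRec
  natCast n := ⟨n, 0, 0, 0⟩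
  natCast_zero := rfl
  natCast_succ n := by ext <;> simp
  intCast n := ⟨n, 0, 0, 0⟩
  intCast_ofNat n := rfl
  intCast_negSucc n := by
    ext
    · show Int.negSucc n = -((n + 1 : ℕ) : ℤ)
      exact Int.negSucc_eq n
    all_goals rfl

@[simp] theorem intCast_a (n : ℤ) : ((n : ℤ) : Qr).a = n := rfl
@[simp] theorem intCast_b (n : ℤ) : ((n : ℤ) : Qr).b = 0 := rfl
@[simp] theorem intCast_c (n : ℤ) : ((n : ℤ) : Qr).c = 0 := rfl
@[simp] theorem intCast_d (n : ℤ) : ((n : ℤ) : Qr).d = 0 := rfl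
@[simp] theorem ofNat_a (n : ℕ) [n.AtLeastTwo] :
    (OfNat.ofNat n : Qr).a = OfNat.ofNat n := rfl
@[simp] theorem ofNat_b (n : ℕ) [n.AtLeastTwo] :
    (OfNat.ofNat n : Qr).b = 0 := rfl
@[simp] theorem ofNat_c (n : ℕ) [n.AtLeastTwo] :
    (OfNat.ofNat n : Qr).c = 0 := rfl
@[simp] theorem ofNat_d (n : ℕ) [n.AtLeastTwo] :
    (OfNat.ofNat n : Qr).d = 0 := rfl
@[simp] theorem sub_a (x y : Qr) : (x - y).a = x.a - y.a := by simp [sub_eq_add_neg]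
@[simp] theorem sub_b (x y : Qr) : (x - y).b = x.b - y.b := by simp [sub_eq_add_neg]
@[simp] theorem sub_c (x y : Qr) : (x - y).c = x.c - y.c := by simp [sub_eq_add_neg]
@[simp] theorem sub_d (x y : Qr) : (x - y).d = x.d - y.d := by simp [sub_eq_add_neg]

/-- `1 - ρ` is a unit. -/
def eps : Qrˣ where
  val := ⟨1, -1, 0, 0⟩
  inv := ⟨-3, -3, -6, 2⟩
  val_inv := by ext <;> simp
  inv_val := by ext <;> simp

/-- `w` is a unit, with inverse `2 ρ - w`. -/
def w : Qrˣ where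
  val := ⟨0, 0, 1, 0⟩
  inv := ⟨0, 2, -1, 0⟩
  val_inv := by ext <;> simp
  inv_val := by ext <;> simp


theorem sq_mod (v : Qrˣ) : ∃ t : Qr, (v : Qr) ^ 2 = 1 + ((2 : ℤ) : Qr) * t := by
  have h : (v : Qr) * (v⁻¹ : Qrˣ) = 1 := v.mul_inv
  set x : Qr := (v : Qr)
  set y : Qr := ((v⁻¹ : Qrˣ) : Qr)
  have ha := congrArg Qr.a h
  have hc := congrArg Qr.c h
  simp only [mul_a, mul_c, one_a, one_c] at ha hc
  have hodd : Odd ((x.a + x.c) * (y.a + y.c)) := by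
    refine ⟨-x.b * y.b + x.b * y.d + x.d * y.b + 2 * (x.c * y.d + x.d * y.c) + 9 * (x.d * y.d)
      + x.c * y.c, ?_⟩
    linear_combination ha + hc
  obtain ⟨k, hk⟩ := (Int.odd_mul.mp hodd).1
  refine ⟨⟨(2 * k ^ 2 + 2 * k) - 2 * x.b * x.d - x.c ^ 2 - x.a * x.c - 4 * x.c * x.d
      - 8 * x.d ^ 2,
    x.a * x.b - x.c * x.d - 2 * x.d ^ 2, x.a * x.c + x.b ^ 2 - x.d ^ 2,
    x.a * x.d + x.b * x.c + 4 * x.b * x.d + x.c ^ 2 + 8 * x.c * x.d + 16 * x.d ^ 2⟩, ?_⟩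
  rw [sq]
  ext
  · simp only [mul_a, mul_b, mul_c, mul_d, add_a, add_b, add_c, add_d, one_a, one_b, one_c, one_d,
      intCast_a, intCast_b, intCast_c, intCast_d]
    linear_combination (x.a + x.c + 2 * k + 1) * hk
  all_goals
    simp only [mul_a, mul_b, mul_c, mul_d, add_a, add_b, add_c, add_d, one_a, one_b, one_c, one_d,
      intCast_a, intCast_b, intCast_c, intCast_d]
    ring

theorem pow_mod (v : Qrˣ) (k : ℕ) :
    ∃ t : Qr, (v : Qr) ^ 2 ^ (k + 1) = 1 + ((2 ^ (k + 1) : ℤ) : Qr) * t := by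
  induction k with
  | zero => simpa using sq_mod v
  | succ k ih =>
    obtain ⟨t, ht⟩ := ih
    refine ⟨t + ((2 ^ k : ℤ) : Qr) * t ^ 2, ?_⟩
    rw [pow_succ 2 (k + 1), pow_mul, ht]
    push_cast
    ring

theorem four_pow (x A : Qr) (h : ∃ t, x ^ 2 ^ 3 = 1 + ((2 ^ 3 : ℤ) : Qr) * (A + ((4 : ℤ) : Qr) * t))
    (k : ℕ) :
    ∃ t, x ^ 2 ^ (k + 3) = 1 + ((2 ^ (k + 3) : ℤ) : Qr) * (A + ((4 : ℤ) : Qr) * t) := by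
  induction k with
  | zero => simpa using h
  | succ k ih =>
    obtain ⟨t, ht⟩ := ih
    refine ⟨t + ((2 ^ k : ℤ) : Qr) * (A + ((4 : ℤ) : Qr) * t) ^ 2, ?_⟩
    rw [show k + 1 + 3 = k + 3 + 1 by ring, pow_succ 2 (k + 3), pow_mul, ht]
    push_cast
    ring

theorem one_add_pow (x A : Qr) (k : ℕ)
    (h : ∃ t, x = 1 + ((2 ^ (k + 3) : ℤ) : Qr) * (A + ((4 : ℤ) : Qr) * t)) (I : ℕ) :
    ∃ t, x ^ I = 1 + ((2 ^ (k + 3) : ℤ) : Qr) * (((I : ℤ) : Qr) * A + ((4 : ℤ) : Qr) * t) := by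
  induction I with
  | zero => exact ⟨0, by simp⟩
  | succ I ih =>
    obtain ⟨t, ht⟩ := h
    obtain ⟨t', ht'⟩ := ih
    refine ⟨t + t' + ((2 ^ (k + 1) : ℤ) : Qr) * ((I : ℤ) * A + ((4 : ℤ) : Qr) * t')
      * (A + ((4 : ℤ) : Qr) * t), ?_⟩
    rw [pow_succ, ht', ht]
    push_cast
    ring

theorem eps_pow (k : ℕ) : ∃ t, (eps : Qr) ^ 2 ^ (k + 3) =
    1 + ((2 ^ (k + 3) : ℤ) : Qr) * (⟨3, 3, 3, 0⟩ + ((4 : ℤ) : Qr) * t) := by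
  apply four_pow
  refine ⟨⟨-5, 0, -2, 6⟩, ?_⟩
  have h2 : (eps : Qr) ^ 2 = ⟨1, -2, 2, 0⟩ := by
    rw [sq]; ext <;> simp [eps]
  rw [show 2 ^ 3 = 2 * 2 * 2 by norm_num, pow_mul, pow_mul, h2]
  simp only [sq]
  ext <;> simp only [mul_a, mul_b, mul_c, mul_d, add_a, add_b, add_c, add_d, one_a, one_b, one_c, one_d,
      intCast_a, intCast_b, intCast_c, intCast_d] <;> norm_num

theorem w_pow (k : ℕ) : ∃ t, (w : Qr) ^ 2 ^ (k + 3) =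
    1 + ((2 ^ (k + 3) : ℤ) : Qr) * (⟨0, 0, 2, 3⟩ + ((4 : ℤ) : Qr) * t) := by
  apply four_pow
  refine ⟨⟨-7070, -1797, -914, 13907⟩, ?_⟩
  have h2 : (w : Qr) ^ 2 = ⟨-1, 0, 0, 2⟩ := by
    rw [sq]; ext <;> simp [w]
  rw [show 2 ^ 3 = 2 * 2 * 2 by norm_num, pow_mul, pow_mul, h2]
  simp only [sq]
  ext <;> simp only [mul_a, mul_b, mul_c, mul_d, add_a, add_b, add_c, add_d, one_a, one_b, one_c, one_d,
      intCast_a, intCast_b, intCast_c, intCast_d] <;> norm_num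

/-- Every unit is, up to sign, `eps ^ i * w ^ j` times a square. -/
def Gen : Prop := ∀ u : Qrˣ, ∃ (s : Qrˣ) (i j : ℕ) (v : Qrˣ), s ^ 2 = 1 ∧ ((s : Qr) = 1 ∨ (s : Qr) = -1) ∧
  i < 2 ∧ j < 2 ∧ u = s * eps ^ i * w ^ j * v ^ 2

theorem gen_pow (H : Gen) (k : ℕ) (u : Qrˣ) : ∃ (s : Qrˣ) (i j : ℕ) (v : Qrˣ), s ^ 2 = 1 ∧
    ((s : Qr) = 1 ∨ (s : Qr) = -1) ∧
    i < 2 ^ k ∧ j < 2 ^ k ∧ u = s * eps ^ i * w ^ j * v ^ 2 ^ k := by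
  induction k with
  | zero => exact ⟨1, 0, 0, u, by simp⟩
  | succ k ih =>
    obtain ⟨s, i, j, v, hs, hs', hi, hj, hu⟩ := ih
    obtain ⟨r, i', j', v', hr, hr', hi', hj', hv⟩ := H v
    have hr2 : ∃ z : Qrˣ, r ^ 2 ^ k = z ∧ z ^ 2 = 1 ∧ ((z : Qr) = 1 ∨ (z : Qr) = -1) := by
      cases k with
      | zero => exact ⟨r, by simp, hr, hr'⟩
      | succ k => exact ⟨1, by rw [pow_succ', pow_mul, hr, one_pow], by simp⟩
    obtain ⟨z, hz, hz2, hz'⟩ := hr2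
    refine ⟨s * z, i + 2 ^ k * i', j + 2 ^ k * j', v', ?_, ?_, ?_, ?_, ?_⟩
    · rw [mul_pow, hs, hz2, one_mul]
    · rw [Units.val_mul]
      rcases hs' with h | h <;> rcases hz' with h' | h' <;> rw [h, h'] <;> simp
    · rw [pow_succ]; nlinarith
    · rw [pow_succ]; nlinarith
    · rw [hu, hv, mul_pow, mul_pow, mul_pow, hz, pow_add, pow_add, pow_mul, pow_mul, pow_succ' 2 k,
        pow_mul v', ← pow_mul eps, ← pow_mul eps, ← pow_mul w, ← pow_mul w, mul_comm i', mul_comm j']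
      simp only [mul_assoc, mul_left_comm, mul_comm]

/-- One step of the 2-adic descent. -/
theorem step (H : Gen) (u base : Qrˣ) (k : ℕ) (v : Qrˣ) (h : u = base * v ^ 2 ^ (k + 3))
    (hcoord : ∀ I J : ℤ, ∀ t : Qr,
      (u : Qr) = base * (1 + ((2 ^ (k + 3) : ℤ) : Qr) * ((I : Qr) * ⟨3, 3, 3, 0⟩ +
        (J : Qr) * ⟨0, 0, 2, 3⟩ + ((4 : ℤ) : Qr) * t)) → 2 ∣ I ∧ 2 ∣ J) :
    ∃ v' : Qrˣ, u = base * v' ^ 2 ^ (k + 1 + 3) := by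
  obtain ⟨s, i, j, v1, hs, hs', hi, hj, hv⟩ := gen_pow H 2 v
  obtain ⟨t1, ht1⟩ := one_add_pow _ _ k (eps_pow k) i
  obtain ⟨t2, ht2⟩ := one_add_pow _ _ k (w_pow k) j
  obtain ⟨t3, ht3⟩ := pow_mod v1 (k + 4)
  have hsk : s ^ 2 ^ (k + 3) = 1 := by rw [pow_succ', pow_mul, hs, one_pow]
  have hv2 : v ^ 2 ^ (k + 3) = (eps ^ 2 ^ (k + 3)) ^ i * (w ^ 2 ^ (k + 3)) ^ j
      * v1 ^ 2 ^ (k + 5) := by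
    rw [hv, mul_pow, mul_pow, mul_pow, hsk, one_mul, ← pow_mul, ← pow_mul, ← pow_mul, ← pow_mul,
      ← pow_mul, mul_comm i, mul_comm j, ← pow_add, show 2 + (k + 3) = k + 5 by ring]
  obtain ⟨⟨i', hi'⟩, ⟨j', hj'⟩⟩ := hcoord i j (t1 + t2 + t3 +
      ((2 ^ (k + 1) : ℤ) : Qr) * (
      ((i : ℤ) * ⟨3, 3, 3, 0⟩ + ((4 : ℤ) : Qr) * t1) * ((j : ℤ) * ⟨0, 0, 2, 3⟩ + ((4 : ℤ) : Qr) * t2)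
      + ((i : ℤ) * ⟨3, 3, 3, 0⟩ + ((4 : ℤ) : Qr) * t1) * (((4 : ℤ) : Qr) * t3)
      + ((j : ℤ) * ⟨0, 0, 2, 3⟩ + ((4 : ℤ) : Qr) * t2) * (((4 : ℤ) : Qr) * t3)
      + ((2 ^ (k + 3) : ℤ) : Qr) * (((i : ℤ) * ⟨3, 3, 3, 0⟩ + ((4 : ℤ) : Qr) * t1)
        * ((j : ℤ) * ⟨0, 0, 2, 3⟩ + ((4 : ℤ) : Qr) * t2) * (((4 : ℤ) : Qr) * t3)))) (by
    rw [h, hv2]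
    push_cast
    push_cast at ht1 ht2 ht3
    rw [ht1, ht2, ht3]
    ring)
  have hi2 : i = 2 * i'.toNat := by omega
  have hj2 : j = 2 * j'.toNat := by omega
  refine ⟨eps ^ i'.toNat * w ^ j'.toNat * v1 ^ 2, ?_⟩
  rw [h, hv2, hi2, hj2, mul_pow, mul_pow]
  simp only [← pow_mul]
  congr 3
  · congr 1; ring
  · congr 1; ring
  · congr 1; ring

theorem descent (H : Gen) (u base : Qrˣ) (v : Qrˣ) (h : u = base * v ^ 2 ^ 3)
    (hcoord : ∀ k : ℕ, ∀ I J : ℤ, ∀ t : Qr,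
      (u : Qr) = base * (1 + ((2 ^ (k + 3) : ℤ) : Qr) * ((I : Qr) * ⟨3, 3, 3, 0⟩ +
        (J : Qr) * ⟨0, 0, 2, 3⟩ + ((4 : ℤ) : Qr) * t)) → 2 ∣ I ∧ 2 ∣ J) :
    u = base := by
  have key : ∀ k : ℕ, ∃ v' : Qrˣ, u = base * v' ^ 2 ^ (k + 3) := by
    intro k
    induction k with
    | zero => exact ⟨v, by simpa using h⟩
    | succ k ih =>
      obtain ⟨v', hv'⟩ := ih
      exact step H u base k v' hv' (hcoord k)
  have key2 : ∀ k : ℕ, ∃ t : Qr, (u : Qr) - base = ((2 ^ (k + 3) : ℤ) : Qr) * t := by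
    intro k
    obtain ⟨v', hv'⟩ := key k
    obtain ⟨t, ht⟩ := pow_mod v' (k + 2)
    refine ⟨base * t, ?_⟩
    rw [hv']
    push_cast
    push_cast at ht
    rw [ht]
    ring
  have key3 : ∀ z : ℤ, (∀ k : ℕ, (2 ^ (k + 3) : ℤ) ∣ z) → z = 0 := by
    intro z hz
    by_contra hne
    have h1 := Int.le_of_dvd (abs_pos.mpr hne) ((dvd_abs _ _).mpr (hz z.natAbs))
    have h2 : z.natAbs < 2 ^ z.natAbs := Nat.lt_two_pow_self
    have h3 : (2 : ℤ) ^ z.natAbs ≤ 2 ^ (z.natAbs + 3) := pow_le_pow_right₀ (by norm_num) (by omega)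
    have h4 : ((z.natAbs : ℕ) : ℤ) < 2 ^ z.natAbs := by exact_mod_cast h2
    rw [Int.natCast_natAbs] at h4
    linarith
  apply Units.ext
  rw [← sub_eq_zero]
  ext
  all_goals
    apply key3
    intro k
    obtain ⟨t, ht⟩ := key2 k
    rw [ht]
    simp only [mul_a, mul_b, mul_c, mul_d, add_a, add_b, add_c, add_d, one_a, one_b, one_c, one_d,
      intCast_a, intCast_b, intCast_c, intCast_d]
    exact ⟨_, by ring⟩

end Qr

open Polynomial in
theorem monic_two (q : ℤ[X]) (hq : q.Monic) (h2 : q.natDegree = 2) :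
    ∃ a b : ℤ, q = X ^ 2 + C a * X + C b := by
  have := q.as_sum_range_C_mul_X_pow
  have hl : q.coeff 2 = 1 := by rw [← h2]; exact hq
  simp only [h2, Finset.sum_range_succ, Finset.sum_range_zero, zero_add, pow_zero, mul_one,
    pow_one, hl, C_1, one_mul] at this
  exact ⟨q.coeff 1, q.coeff 0, by linear_combination this⟩

open Polynomial in
theorem quartic_irr : Irreducible (X ^ 4 - 8 * X + 4 : ℚ[X]) := by
  have hm : (X ^ 4 - 8 * X + 4 : ℤ[X]).Monic := by monicity!
  have hdeg : (X ^ 4 - 8 * X + 4 : ℤ[X]).natDegree = 4 := by compute_degree!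
  have hZ : Irreducible (X ^ 4 - 8 * X + 4 : ℤ[X]) := by
    rw [hm.irreducible_iff_natDegree']
    constructor
    · intro h
      rw [h] at hdeg
      simp at hdeg
    · intro p q hp hq hpq hmem
      rw [hdeg, Finset.mem_Ioc] at hmem
      have hsum : p.natDegree + q.natDegree = 4 := by
        rw [← hp.natDegree_mul hq, hpq, hdeg]
      have hcases : q.natDegree = 1 ∨ q.natDegree = 2 := by omega
      rcases hcases with h1 | h2
      · have hq1 : q = X + C (q.coeff 0) := hq.eq_X_add_C h1
        have := congrArg (eval (-(q.coeff 0))) hpq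
        rw [hq1] at this
        simp at this
        generalize q.coeff 0 = r at this
        have h3 : (4 : ℤ) = r ^ 4 * (-1) - 8 * r := by linear_combination -this
        have h4 : Even r := by
          by_contra h
          rw [Int.not_even_iff_odd] at h
          have : Odd (r ^ 4) := h.pow
          rcases this with ⟨k, hk⟩
          omega
        obtain ⟨k, rfl⟩ := h4
        have : (4 : ℤ) = 16 * (-k ^ 4 - k) := by linear_combination h3
        omega
      · have hp2 : p.natDegree = 2 := by omega
        obtain ⟨a, b, hqe⟩ := monic_two q hq h2
        obtain ⟨c, d, hpe⟩ := monic_two p hp hp2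
        rw [hqe, hpe] at hpq
        have e0 := congrArg (eval 0) hpq
        have e1 := congrArg (eval 1) hpq
        have e2 := congrArg (eval (-1)) hpq
        have e3 := congrArg (eval 2) hpq
        simp only [eval_mul, eval_add, eval_sub, eval_pow, eval_X, eval_C, eval_ofNat] at e0 e1 e2 e3
        have f0 : b * d = 4 := by linear_combination e0
        have f1 : a + c = 0 := by linarith
        obtain rfl : c = -a := by linarith
        have f2 : b + d - a * a = 0 := by linarith
        have f3 : a * d - b * a = -8 := by linarith
        have hb : b ∣ 4 := ⟨d, f0.symm⟩
        have hb1 := Int.le_of_dvd (by norm_num) hb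
        have hb2 := Int.le_of_dvd (by norm_num) ((neg_dvd).mpr hb)
        have hb3 : -4 ≤ b := by linarith
        clear e0 e1 e2 e3 hb hb2
        have hd : d = 4 ∨ d = 1 ∨ d = 2 ∨ d = -4 ∨ d = -1 ∨ d = -2 := by
          interval_cases b <;> omega
        rcases hd with rfl | rfl | rfl | rfl | rfl | rfl
        · obtain rfl : b = 1 := by omega
          omega
        · obtain rfl : b = 4 := by omega
          omega
        · obtain rfl : b = 2 := by omega
          omega
        all_goals nlinarith [mul_self_nonneg a]
  have := (IsPrimitive.Int.irreducible_iff_irreducible_map_cast hm.isPrimitive).mp hZ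
  simpa using this

theorem three_roots (r s q : ℝ) (hr : r ^ 4 - 8 * r + 4 = 0) (hs : s ^ 4 - 8 * s + 4 = 0)
    (hq : q ^ 4 - 8 * q + 4 = 0) (hrs : r ≠ s) (hrq : r ≠ q) (hsq : s ≠ q) : False := by
  have h1 : r ^ 3 + r ^ 2 * s + r * s ^ 2 + s ^ 3 - 8 = 0 := by
    apply mul_left_cancel₀ (sub_ne_zero.mpr hrs)
    linear_combination hr - hs
  have h2 : r ^ 3 + r ^ 2 * q + r * q ^ 2 + q ^ 3 - 8 = 0 := by
    apply mul_left_cancel₀ (sub_ne_zero.mpr hrq)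
    linear_combination hr - hq
  have h3 : r ^ 2 + s ^ 2 + q ^ 2 + r * s + s * q + q * r = 0 := by
    apply mul_left_cancel₀ (sub_ne_zero.mpr hsq)
    linear_combination h1 - h2
  have h4 : r = 0 := by
    have : r ^ 2 ≤ 0 := by nlinarith [sq_nonneg (r + s), sq_nonneg (s + q), sq_nonneg (q + r), sq_nonneg s, sq_nonneg q]
    exact pow_eq_zero_iff (two_ne_zero) |>.mp (le_antisymm this (sq_nonneg r))
  rw [h4] at hr
  norm_num at hr

open NumberField in
theorem rank_le_two {L : Type*} [Field L] [NumberField L] (t : L) (ht : t ^ 4 - 8 * t + 4 = 0)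
    (hfin : Module.finrank ℚ L = 4)
    (hext : ∀ φ ψ : L →+* ℂ, φ t = ψ t → φ = ψ) : Units.rank L < 3 := by
  have h1 := InfinitePlace.card_add_two_mul_card_eq_rank L
  have h2 := InfinitePlace.card_eq_nrRealPlaces_add_nrComplexPlaces L
  rw [hfin] at h1
  have h3 : Units.rank L = Fintype.card (InfinitePlace L) - 1 := rfl
  by_contra hcon
  have h4 : InfinitePlace.nrComplexPlaces L = 0 := by omega
  have hreal : ∀ φ : L →+* ℂ, ∃ r : ℝ, φ t = r := by
    intro φ
    have hφ : ComplexEmbedding.IsReal φ := by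
      by_contra hφ
      rw [← InfinitePlace.isComplex_mk_iff] at hφ
      have : 0 < InfinitePlace.nrComplexPlaces L := by
        classical
        exact Fintype.card_pos_iff.mpr ⟨⟨_, hφ⟩⟩
      omega
    have := congrArg (fun f : L →+* ℂ => f t) hφ
    obtain ⟨r, hr⟩ := Complex.conj_eq_iff_real.mp this
    exact ⟨r, hr⟩
  have hcard : 2 < Fintype.card (L →+* ℂ) := by
    rw [NumberField.Embeddings.card, hfin]; norm_num
  obtain ⟨φ, ψ, χ, h12, h13, h23⟩ := Fintype.two_lt_card_iff.mp hcard
  obtain ⟨r, hr⟩ := hreal φ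
  obtain ⟨s, hs⟩ := hreal ψ
  obtain ⟨q, hq⟩ := hreal χ
  have key : ∀ (φ : L →+* ℂ) (r : ℝ), φ t = r → r ^ 4 - 8 * r + 4 = 0 := by
    intro φ r hr
    have := congrArg φ ht
    simp only [map_add, map_sub, map_mul, map_pow, hr, map_ofNat, map_zero] at this
    exact_mod_cast this
  refine three_roots r s q (key φ r hr) (key ψ s hs) (key χ q hq) ?_ ?_ ?_
  · rintro rfl; exact h12 (hext _ _ (hr.trans hs.symm))
  · rintro rfl; exact h13 (hext _ _ (hr.trans hq.symm))
  · rintro rfl; exact h23 (hext _ _ (hs.trans hq.symm))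

namespace Qr

/-- The homomorphism from the order to a ring containing `ρ` and `w`. -/
def toRing {R : Type*} [CommRing R] (r v : R) (hr : r ^ 2 = 2 * v) (hv : v ^ 2 = 2 * r * v - 1) :
    Qr →+* R where
  toFun x := x.a + x.b * r + x.c * v + x.d * (r * v)
  map_one' := by simp
  map_zero' := by simp
  map_add' x y := by simp; ring
  map_mul' x y := by
    simp only [mul_a, mul_b, mul_c, mul_d]
    push_cast
    linear_combination (-(x.b * y.b) : R) * hr - (x.b * y.d + x.d * y.b : R) * (v * hr + 2 * hv)
      - (x.c * y.c : R) * hv - (x.c * y.d + x.d * y.c : R) * (r * hv + 2 * (v * hr + 2 * hv))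
      - (x.d * y.d : R) * (v ^ 2 * hr + 2 * v * hv + 4 * (r * hv + 2 * (v * hr + 2 * hv)))

theorem toRing_integral {R : Type*} [CommRing R] (r v : R) (hr : r ^ 2 = 2 * v)
    (hv : v ^ 2 = 2 * r * v - 1) (x : Qr) : IsIntegral ℤ (toRing r v hr hv x) := by
  have h1 : IsIntegral ℤ v := by
    refine ⟨Polynomial.X ^ 4 - 8 * Polynomial.X ^ 3 + 2 * Polynomial.X ^ 2 + 1, by monicity!, ?_⟩
    simp
    linear_combination (v ^ 2 + 1 + 2 * r * v) * hv + 4 * v ^ 2 * hr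
  have h2 : IsIntegral ℤ r := by
    refine IsIntegral.of_pow (n := 2) (by norm_num) ?_
    rw [hr]
    simpa using (isIntegral_algebraMap (R := ℤ) (x := (2 : ℤ)) (A := R)).mul h1
  have h3 : ∀ n : ℤ, IsIntegral ℤ (n : R) := fun n => by
    simpa using (isIntegral_algebraMap (R := ℤ) (x := n) (A := R))
  exact (((h3 _).add ((h3 _).mul h2)).add ((h3 _).mul h1)).add ((h3 _).mul (h2.mul h1))

open NumberField in
theorem gen_of_field {L : Type*} [Field L] [NumberField L] (t : L) (ht : t ^ 4 - 8 * t + 4 = 0)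
    (hfin : Module.finrank ℚ L = 4)
    (hext : ∀ φ ψ : L →+* ℂ, φ t = ψ t → φ = ψ)
    (hlin : ∀ a b c d : ℤ, (a : L) + b * t + c * t ^ 2 + d * t ^ 3 = 0 →
      a = 0 ∧ b = 0 ∧ c = 0 ∧ d = 0)
    (φ : L →+* ℝ) : Gen := by
  have h0 : t ≠ 0 := by rintro rfl; norm_num at ht
  have hr : (2 / t) ^ 2 = 2 * (2 / t ^ 2) := by field_simp
  have hv : (2 / t ^ 2) ^ 2 = 2 * (2 / t) * (2 / t ^ 2) - 1 := by
    field_simp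
    linear_combination ht
  let F : Qr →+* 𝓞 L := (toRing _ _ hr hv).codRestrict (integralClosure ℤ L)
    (fun x => toRing_integral _ _ hr hv x)
  have hF : Function.Injective F := by
    rw [injective_iff_map_eq_zero]
    intro x hx
    have hx' : (x.a : L) + x.b * (2 / t) + x.c * (2 / t ^ 2) + x.d * ((2 / t) * (2 / t ^ 2)) = 0 :=
      congrArg (fun z : 𝓞 L => (z : L)) hx
    field_simp at hx'
    have := hlin (4 * x.d) (2 * x.c) (2 * x.b) x.a (by push_cast; linear_combination hx')
    ext <;> simp <;> omega
  intro u
  obtain ⟨c, hodd, hc⟩ := units_rel φ F hF 3 (rank_le_two t ht hfin hext) ![eps, w, u]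
  simp only [Fin.prod_univ_three, Matrix.cons_val_zero, Matrix.cons_val_one, Matrix.cons_val] at hc
  rw [Fin.exists_fin_succ, Fin.exists_fin_succ, Fin.exists_fin_succ] at hodd
  have hodd' : Odd (c 0) ∨ Odd (c 1) ∨ Odd (c 2) := by simpa using hodd
  generalize c 0 = A at hc hodd'
  generalize c 1 = B at hc hodd'
  generalize c 2 = C at hc hodd'
  obtain ⟨s, hs⟩ : ∃ s : Qrˣ, s = eps ^ A * w ^ B * u ^ C := ⟨_, rfl⟩
  rw [← hs] at hc
  have hs2 : s ^ 2 = 1 := by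
    apply Units.ext
    rcases hc with h | h <;> simp [h]
  have hsplit : ∀ A : ℤ, ∃ (i : ℕ) (A' : ℤ), i < 2 ∧ A = i + 2 * A' ∧ (Odd A ↔ i = 1) := by
    intro A
    rcases Int.even_or_odd' A with ⟨k, h | h⟩
    · exact ⟨0, k, by norm_num, by simp [h], by simp [h]⟩
    · exact ⟨1, k, by norm_num, by rw [h]; push_cast; ring, by simp [h]⟩
  obtain ⟨i, A', hi, hA, hiA⟩ := hsplit A
  obtain ⟨j, B', hj, hB, hjB⟩ := hsplit B
  obtain ⟨k, C', hk, hC, hkC⟩ := hsplit C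
  rw [hiA, hjB, hkC] at hodd'
  have hs' : s = eps ^ i * w ^ j * u ^ k * (eps ^ A' * w ^ B' * u ^ C') ^ 2 := by
    rw [hs, hA, hB, hC, zpow_add, zpow_add, zpow_add, mul_pow, mul_pow]
    simp only [zpow_mul', zpow_natCast, zpow_ofNat]
    simp only [mul_assoc, mul_left_comm, mul_comm]
  generalize eps ^ A' * w ^ B' * u ^ C' = V at hs'
  have hk' : k = 0 ∨ k = 1 := by omega
  rcases hk' with rfl | rfl
  · exfalso
    obtain ⟨t, ht⟩ := sq_mod V⁻¹
    have h1 : eps ^ i * w ^ j = s * V⁻¹ ^ 2 := by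
      rw [hs']; simp
    have h2 := congrArg Units.val h1
    rw [Units.val_mul, Units.val_mul, Units.val_pow_eq_pow_val, Units.val_pow_eq_pow_val,
      Units.val_pow_eq_pow_val, ht] at h2
    have hb := congrArg Qr.b h2
    have hcc := congrArg Qr.c h2
    have hij : (i = 0 ∧ j = 1) ∨ (i = 1 ∧ j = 0) ∨ (i = 1 ∧ j = 1) := by omega
    rcases hij with ⟨rfl, rfl⟩ | ⟨rfl, rfl⟩ | ⟨rfl, rfl⟩ <;> rcases hc with h | h <;>
    simp only [h, pow_zero, pow_one, one_mul, mul_one, eps, w,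
        mul_a, mul_b, mul_c, mul_d, add_a, add_b, add_c, add_d, one_a, one_b, one_c, one_d,
        neg_a, neg_b, neg_c, neg_d,
        intCast_a, intCast_b, intCast_c, intCast_d] at hb hcc <;> omega
  · refine ⟨s, i, j, (V * eps ^ i * w ^ j)⁻¹, hs2, hc, hi, hj, ?_⟩
    rw [hs', inv_pow, eq_mul_inv_iff_mul_eq, mul_pow, mul_pow]
    simp only [pow_one, sq]
    simp only [mul_assoc, mul_left_comm, mul_comm]

end Qr

open Polynomial in
/-- Facts about the number field generated by a root of a monic irreducible rational polynomial. -/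
theorem adjoin_facts (f : ℚ[X]) (hf : Irreducible f) (φr : ℝ)
    (hφ : f.eval₂ (algebraMap ℚ ℝ) φr = 0) :
    ∃ (L : Type) (_ : Field L) (_ : NumberField L) (t : L), eval₂ (algebraMap ℚ L) t f = 0 ∧
      Module.finrank ℚ L = f.natDegree ∧ (∀ φ ψ : L →+* ℂ, φ t = ψ t → φ = ψ) ∧
      (∀ p : ℚ[X], p.natDegree < f.natDegree → eval₂ (algebraMap ℚ L) t p = 0 → p = 0) ∧
      (∃ b : Module.Basis (Fin f.natDegree) ℚ L, ∀ i, b i = t ^ (i : ℕ)) ∧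
      Nonempty (L →+* ℝ) := by
  have : Fact (Irreducible f) := ⟨hf⟩
  have hne : f ≠ 0 := hf.ne_zero
  have : CharZero (AdjoinRoot f) := algebraRat.charZero _
  have : FiniteDimensional ℚ (AdjoinRoot f) := (AdjoinRoot.powerBasis hne).finite
  refine ⟨AdjoinRoot f, inferInstance, ⟨⟩, AdjoinRoot.root f, ?_, ?_, ?_, ?_, ?_, ?_⟩
  · exact AdjoinRoot.eval₂_root f
  · rw [(AdjoinRoot.powerBasis hne).finrank, AdjoinRoot.powerBasis_dim]
  · intro φ ψ h
    refine AdjoinRoot.ringHom_ext ?_ h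
    exact Subsingleton.elim _ _
  · intro p hp h
    have h2 : AdjoinRoot.mk f p = 0 := by
      rw [← AdjoinRoot.aeval_eq]; exact h
    rw [AdjoinRoot.mk_eq_zero] at h2
    exact Polynomial.eq_zero_of_dvd_of_natDegree_lt h2 hp
  · exact ⟨(AdjoinRoot.powerBasis hne).basis.reindex (finCongr (AdjoinRoot.powerBasis_dim hne)), by
      intro i; simp⟩
  · exact ⟨AdjoinRoot.lift (algebraMap ℚ ℝ) φr hφ⟩

open Polynomial in
theorem gen_true : Qr.Gen := by
  have hdeg : (X ^ 4 - 8 * X + 4 : ℚ[X]).natDegree = 4 := by compute_degree!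
  obtain ⟨r, hr⟩ : ∃ r : ℝ, r ^ 4 - 8 * r + 4 = 0 := by
    have hc : ContinuousOn (fun r : ℝ => r ^ 4 - 8 * r + 4) (Set.Icc 0 1) := by fun_prop
    obtain ⟨r, -, hr⟩ := intermediate_value_Icc' (zero_le_one) hc
      (show (0 : ℝ) ∈ _ by constructor <;> norm_num)
    exact ⟨r, hr⟩
  obtain ⟨L, _, _, t, ht, hfin, hext, hlin, -, ⟨φ⟩⟩ := adjoin_facts _ quartic_irr r (by simpa using hr)
  refine Qr.gen_of_field t (by simpa using ht) (by rw [hfin, hdeg]) hext ?_ φ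
  intro a b c d h
  have := hlin (C (a : ℚ) + C (b : ℚ) * X + C (c : ℚ) * X ^ 2 + C (d : ℚ) * X ^ 3) (by
    rw [hdeg]
    have : (C (a : ℚ) + C (b : ℚ) * X + C (c : ℚ) * X ^ 2 + C (d : ℚ) * X ^ 3).natDegree ≤ 3 := by
      compute_degree!
    omega) (by
    simp only [eval₂_add, eval₂_mul, eval₂_C, eval₂_X, eval₂_pow]
    simp only [map_intCast]
    exact h)
  have e0 := congrArg (fun p : ℚ[X] => p.coeff 0) this
  have e1 := congrArg (fun p : ℚ[X] => p.coeff 1) this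
  have e2 := congrArg (fun p : ℚ[X] => p.coeff 2) this
  have e3 := congrArg (fun p : ℚ[X] => p.coeff 3) this
  simp only [coeff_add, coeff_C_mul, coeff_X_pow, coeff_X, coeff_C] at e0 e1 e2 e3
  norm_num at e0 e1 e2 e3
  exact ⟨e0, e1, e2, e3⟩

/-- The ring `ℤ[θ]` with `θ ^ 3 = θ - 1`. -/
@[ext] structure Z3 where
  a : ℤ
  b : ℤ
  c : ℤ

namespace Z3

instance : Zero Z3 := ⟨⟨0, 0, 0⟩⟩
instance : One Z3 := ⟨⟨1, 0, 0⟩⟩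
instance : Add Z3 := ⟨fun x y => ⟨x.a + y.a, x.b + y.b, x.c + y.c⟩⟩
instance : Neg Z3 := ⟨fun x => ⟨-x.a, -x.b, -x.c⟩⟩
instance : Mul Z3 := ⟨fun x y =>
  ⟨x.a * y.a - (x.b * y.c + x.c * y.b),
   x.a * y.b + x.b * y.a + (x.b * y.c + x.c * y.b) - x.c * y.c,
   x.a * y.c + x.c * y.a + x.b * y.b + x.c * y.c⟩⟩

@[simp] theorem zero_a : (0 : Z3).a = 0 := rfl
@[simp] theorem zero_b : (0 : Z3).b = 0 := rfl
@[simp] theorem zero_c : (0 : Z3).c = 0 := rfl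
@[simp] theorem one_a : (1 : Z3).a = 1 := rfl
@[simp] theorem one_b : (1 : Z3).b = 0 := rfl
@[simp] theorem one_c : (1 : Z3).c = 0 := rfl
@[simp] theorem add_a (x y : Z3) : (x + y).a = x.a + y.a := rfl
@[simp] theorem add_b (x y : Z3) : (x + y).b = x.b + y.b := rfl
@[simp] theorem add_c (x y : Z3) : (x + y).c = x.c + y.c := rfl
@[simp] theorem neg_a (x : Z3) : (-x).a = -x.a := rfl
@[simp] theorem neg_b (x : Z3) : (-x).b = -x.b := rfl
@[simp] theorem neg_c (x : Z3) : (-x).c = -x.c := rfl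
@[simp] theorem mul_a (x y : Z3) : (x * y).a = x.a * y.a - (x.b * y.c + x.c * y.b) := rfl
@[simp] theorem mul_b (x y : Z3) : (x * y).b =
    x.a * y.b + x.b * y.a + (x.b * y.c + x.c * y.b) - x.c * y.c := rfl
@[simp] theorem mul_c (x y : Z3) : (x * y).c =
    x.a * y.c + x.c * y.a + x.b * y.b + x.c * y.c := rfl

instance : CommRing Z3 where
  add_assoc x y z := by ext <;> simp <;> ring
  zero_add x := by ext <;> simp
  add_zero x := by ext <;> simp
  add_comm x y := by ext <;> simp <;> ring
  neg_add_cancel x := by ext <;> simp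
  mul_assoc x y z := by ext <;> simp <;> ring
  one_mul x := by ext <;> simp
  mul_one x := by ext <;> simp
  mul_comm x y := by ext <;> simp <;> ring
  left_distrib x y z := by ext <;> simp <;> ring
  right_distrib x y z := by ext <;> simp <;> ring
  zero_mul x := by ext <;> simp
  mul_zero x := by ext <;> simp
  nsmul := nsmulRec
  zsmul := zsmulRec
  natCast n := ⟨n, 0, 0⟩
  natCast_zero := rfl
  natCast_succ n := by ext <;> simp
  intCast n := ⟨n, 0, 0⟩
  intCast_ofNat n := rfl
  intCast_negSucc n := by
    ext
    · show Int.negSucc n = -((n + 1 : ℕ) : ℤ)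
      exact Int.negSucc_eq n
    all_goals rfl

@[simp] theorem intCast_a (n : ℤ) : ((n : ℤ) : Z3).a = n := rfl
@[simp] theorem intCast_b (n : ℤ) : ((n : ℤ) : Z3).b = 0 := rfl
@[simp] theorem intCast_c (n : ℤ) : ((n : ℤ) : Z3).c = 0 := rfl

/-- The unit `θ`, with inverse `1 - θ ^ 2`. -/
def th : Z3ˣ where
  val := ⟨0, 1, 0⟩
  inv := ⟨1, 0, -1⟩
  val_inv := by ext <;> simp
  inv_val := by ext <;> simp

/-- The norm form, as a homomorphism of monoids. -/
def norm : Z3 →* ℤ where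
  toFun x := x.a ^ 3 + 2 * x.a ^ 2 * x.c - x.a * x.b ^ 2 + 3 * x.a * x.b * x.c + x.a * x.c ^ 2
    - x.b ^ 3 + x.b * x.c ^ 2 + x.c ^ 3
  map_one' := by simp
  map_mul' x y := by
    simp only [mul_a, mul_b, mul_c]
    ring

theorem norm_apply (x : Z3) : norm x = x.a ^ 3 + 2 * x.a ^ 2 * x.c - x.a * x.b ^ 2
    + 3 * x.a * x.b * x.c + x.a * x.c ^ 2 - x.b ^ 3 + x.b * x.c ^ 2 + x.c ^ 3 := rfl

/-- The homomorphism to a ring containing a root. -/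
def toRing {R : Type*} [CommRing R] (t : R) (ht : t ^ 3 = t - 1) : Z3 →+* R where
  toFun x := x.a + x.b * t + x.c * t ^ 2
  map_one' := by simp
  map_zero' := by simp
  map_add' x y := by simp; ring
  map_mul' x y := by
    simp only [mul_a, mul_b, mul_c]
    push_cast
    linear_combination (-(x.b * y.c + x.c * y.b) - (x.c * y.c) * t : R) * ht

theorem toRing_apply {R : Type*} [CommRing R] (t : R) (ht : t ^ 3 = t - 1) (x : Z3) :
    toRing t ht x = x.a + x.b * t + x.c * t ^ 2 := rfl

end Z3

open Polynomial in
theorem cubic_irr : Irreducible (X ^ 3 - X + 1 : ℚ[X]) := by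
  have hm : (X ^ 3 - X + 1 : ℤ[X]).Monic := by monicity!
  have hdeg : (X ^ 3 - X + 1 : ℤ[X]).natDegree = 3 := by compute_degree!
  have hZ : Irreducible (X ^ 3 - X + 1 : ℤ[X]) := by
    rw [hm.irreducible_iff_natDegree']
    constructor
    · intro h
      rw [h] at hdeg
      simp at hdeg
    · intro p q hp hq hpq hmem
      rw [hdeg, Finset.mem_Ioc] at hmem
      have h1 : q.natDegree = 1 := by omega
      have hq1 : q = X + C (q.coeff 0) := hq.eq_X_add_C h1
      have := congrArg (eval (-(q.coeff 0))) hpq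
      rw [hq1] at this
      simp at this
      generalize q.coeff 0 = r at this
      have h3 : (1 : ℤ) = r * (r ^ 2 - 1) := by
        have : r ^ 3 - r - 1 = 0 := by
          have e : (-r) ^ 3 = -r ^ 3 := by ring
          rw [e] at this
          linarith
        linear_combination -this
      have h4 : IsUnit r := IsUnit.of_mul_eq_one _ h3.symm
      rcases Int.isUnit_iff.mp h4 with rfl | rfl <;> norm_num at h3
  have := (IsPrimitive.Int.irreducible_iff_irreducible_map_cast hm.isPrimitive).mp hZ
  simpa using this

open NumberField in
theorem cubic_discr {K : Type*} [Field K] [NumberField K] (t : K) (ht : t ^ 3 = t - 1)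
    (b : Module.Basis (Fin 3) ℚ K) (hb : ∀ i, b i = t ^ (i : ℕ)) (T : 𝓞 K)
    (hT : (T : K) = t) :
    NumberField.discr K = -23 ∧ ∀ z : 𝓞 K, ∃ p q r : ℤ, z = p + q * T + r * T ^ 2 := by
  have hfin : Module.finrank ℚ K = 3 := by
    rw [Module.finrank_eq_card_basis b, Fintype.card_fin]
  have tr : ∀ p q r : ℚ, Algebra.trace ℚ K ((p : K) + q * t + r * t ^ 2) = 3 * p + 2 * r := by
    have b0 : b 0 = 1 := by simp [hb]
    have b1 : b 1 = t := by simp [hb]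
    have b2 : b 2 = t ^ 2 := by simp [hb]
    have h1 : Algebra.trace ℚ K t = 0 := by
      rw [Algebra.trace_eq_matrix_trace b, Matrix.trace_fin_three]
      simp only [Algebra.leftMulMatrix_eq_repr_mul]
      rw [show t * b 0 = b 1 by rw [b0, b1, mul_one], show t * b 1 = b 2 by rw [b1, b2, sq],
        show t * b 2 = b 1 - b 0 by rw [b2, b1, b0]; linear_combination ht]
      simp
    have h2 : Algebra.trace ℚ K (t ^ 2) = 2 := by
      rw [Algebra.trace_eq_matrix_trace b, Matrix.trace_fin_three]
      simp only [Algebra.leftMulMatrix_eq_repr_mul]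
      rw [show t ^ 2 * b 0 = b 2 by rw [b0, b2, mul_one],
        show t ^ 2 * b 1 = b 1 - b 0 by rw [b1, b0]; linear_combination ht,
        show t ^ 2 * b 2 = b 2 - b 1 by rw [b2, b1]; linear_combination t * ht]
      simp
      norm_num
    have h0 : Algebra.trace ℚ K 1 = 3 := by
      have := Algebra.trace_algebraMap (R := ℚ) (S := K) (1 : ℚ)
      rw [hfin] at this
      simpa using this
    intro p q r
    have : (p : K) + q * t + r * t ^ 2 = p • (1 : K) + q • t + r • t ^ 2 := by
      simp [Rat.smul_def]
    rw [this, map_add, map_add, map_smul, map_smul, map_smul, h0, h1, h2]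
    simp
    ring
  have htr : ∀ i j : Fin 3, Algebra.traceMatrix ℤ (fun i : Fin 3 => T ^ (i : ℕ)) i j =
      !![3, 0, 2; 0, 2, -3; 2, -3, 2] i j := by
    intro i j
    rw [Algebra.traceMatrix_apply, Algebra.traceForm_apply, ← pow_add]
    apply Int.cast_injective (α := ℚ)
    rw [Algebra.coe_trace_int]
    have e : ((T ^ ((i : ℕ) + j) : 𝓞 K) : K) = t ^ ((i : ℕ) + j) := by rw [← hT]; simp
    rw [e]
    have k0 := tr 1 0 0
    have k1 := tr 0 1 0
    have k2 := tr 0 0 1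
    have k3 := tr (-1) 1 0
    have k4 := tr 0 (-1) 1
    have e3 : t ^ 3 = -1 + t := by linear_combination ht
    have e4 : t ^ 4 = -t + t ^ 2 := by linear_combination t * ht
    fin_cases i <;> fin_cases j <;> simp at k0 k1 k2 k3 k4 ⊢ <;> (try rw [e3]) <;> (try rw [e4]) <;>
      first | assumption | (rw [map_add, map_neg]; assumption)
  have hdisc : Algebra.discr ℤ (fun i : Fin 3 => T ^ (i : ℕ)) = -23 := by
    rw [Algebra.discr_def, show Algebra.traceMatrix ℤ (fun i : Fin 3 => T ^ (i : ℕ)) = _ from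
      Matrix.ext htr, Matrix.det_fin_three]
    simp
  let B : Module.Basis (Fin 3) ℤ (𝓞 K) := (RingOfIntegers.basis K).reindex
    (Fintype.equivOfCardEq (by
      rw [← Module.finrank_eq_card_chooseBasisIndex, RingOfIntegers.rank, hfin, Fintype.card_fin]))
  have h1 := Algebra.discr_of_matrix_vecMul (A := ℤ) B (B.toMatrix (fun i : Fin 3 => T ^ (i : ℕ)))
  rw [Module.Basis.toMatrix_map_vecMul, hdisc, NumberField.discr_eq_discr K B,
    ← Module.Basis.det_apply] at h1
  have hunit : IsUnit (B.det (fun i : Fin 3 => T ^ (i : ℕ))) := by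
    generalize B.det (fun i : Fin 3 => T ^ (i : ℕ)) = d at h1
    have h2 : d * d ∣ 23 := ⟨-discr K, by linear_combination -h1⟩
    have : Squarefree (23 : ℤ) := by
      rw [Int.squarefree_natAbs.symm]
      exact Nat.Prime.prime (by norm_num : Nat.Prime 23) |>.squarefree
    exact this d h2
  constructor
  · rcases Int.isUnit_iff.mp hunit with h | h <;> rw [h] at h1 <;> linarith
  · intro z
    have hz : z ∈ Submodule.span ℤ (Set.range (fun i : Fin 3 => T ^ (i : ℕ))) := by
      rw [(B.is_basis_iff_det.mpr hunit).2]; trivial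
    rw [Submodule.mem_span_range_iff_exists_fun] at hz
    obtain ⟨c, hc⟩ := hz
    refine ⟨c 0, c 1, c 2, ?_⟩
    rw [← hc, Fin.sum_univ_three]
    simp

namespace Z3

/-- Every unit of `Z3` is, up to sign and a power of `θ`, a square. -/
def Good : Prop := (∀ z w : Z3, z * w = 0 → z = 0 ∨ w = 0) ∧ IsPrincipalIdealRing Z3 ∧
  ∀ u : Z3ˣ, ∃ v : Z3, (u : Z3) = v ^ 2 ∨ (u : Z3) = -v ^ 2 ∨ (u : Z3) = th * v ^ 2 ∨
    (u : Z3) = -(th * v ^ 2)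

theorem th_not_sq (v : Z3) : (th : Z3) ≠ v ^ 2 ∧ (th : Z3) ≠ -v ^ 2 := by
  let g : Z3 →+* ZMod 5 := toRing 3 (by decide)
  have hg : g (th : Z3) = 3 := by simp [g, toRing_apply, th]
  constructor
  · intro h
    have := congrArg g h
    rw [hg, map_pow] at this
    generalize g v = x at this
    revert x; decide
  · intro h
    have := congrArg g h
    rw [hg, map_neg, map_pow] at this
    generalize g v = x at this
    revert x; decide

open NumberField in
theorem good_of_field {K : Type*} [Field K] [NumberField K] (t : K) (ht : t ^ 3 = t - 1)
    (b : Module.Basis (Fin 3) ℚ K) (hb : ∀ i, b i = t ^ (i : ℕ))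
    (hlin : ∀ p q r : ℤ, (p : K) + q * t + r * t ^ 2 = 0 → p = 0 ∧ q = 0 ∧ r = 0)
    (φ : K →+* ℝ) : Good := by
  have htint : IsIntegral ℤ t := by
    refine ⟨Polynomial.X ^ 3 - Polynomial.X + 1, by monicity!, ?_⟩
    simp
    linear_combination ht
  let T : 𝓞 K := ⟨t, htint⟩
  have hT : (T : K) = t := rfl
  have hT3 : T ^ 3 = T - 1 := by
    apply RingOfIntegers.ext
    simpa [hT] using ht
  obtain ⟨hdisc, hsurj⟩ := cubic_discr t ht b hb T hT
  have hfin : Module.finrank ℚ K = 3 := by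
    rw [Module.finrank_eq_card_basis b, Fintype.card_fin]
  let F : Z3 →+* 𝓞 K := toRing T hT3
  have hF : Function.Injective F := by
    rw [injective_iff_map_eq_zero]
    intro x hx
    have hx' := congrArg (fun z : 𝓞 K => (z : K)) hx
    simp [F, toRing_apply, hT] at hx'
    obtain ⟨h1, h2, h3⟩ := hlin _ _ _ hx'
    ext <;> assumption
  have hFs : Function.Surjective F := by
    intro z
    obtain ⟨p, q, r, rfl⟩ := hsurj z
    exact ⟨⟨p, q, r⟩, rfl⟩
  let e : Z3 ≃+* 𝓞 K := RingEquiv.ofBijective F ⟨hF, hFs⟩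
  have h1 := InfinitePlace.card_add_two_mul_card_eq_rank K
  have h2 := InfinitePlace.card_eq_nrRealPlaces_add_nrComplexPlaces K
  rw [hfin] at h1
  have h3 : Units.rank K = Fintype.card (InfinitePlace K) - 1 := rfl
  have h4 : InfinitePlace.nrComplexPlaces K = 1 := by
    have hsgn := NumberField.sign_discr K
    rw [hdisc] at hsgn
    have : InfinitePlace.nrComplexPlaces K = 0 ∨ InfinitePlace.nrComplexPlaces K = 1 := by omega
    rcases this with h | h
    · rw [h] at hsgn; exact absurd hsgn (by decide)
    · exact h
  refine ⟨?_, ?_, ?_⟩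
  · intro z w hzw
    have := congrArg F hzw
    rw [map_mul, map_zero, mul_eq_zero] at this
    exact this.imp (fun h => hF (by rw [h, map_zero])) (fun h => hF (by rw [h, map_zero]))
  · have hP : IsPrincipalIdealRing (𝓞 K) := by
      apply RingOfIntegers.isPrincipalIdealRing_of_abs_discr_lt
      rw [hdisc, h4, hfin]
      have hpi := Real.pi_gt_three
      norm_num [Nat.factorial]
      nlinarith
    exact IsPrincipalIdealRing.of_surjective e.symm e.symm.surjective
  · intro u
    obtain ⟨c, hodd, hc⟩ := units_rel φ F hF 2 (by omega) ![th, u]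
    simp only [Fin.prod_univ_two, Matrix.cons_val_zero, Matrix.cons_val_one] at hc
    rw [Fin.exists_fin_two] at hodd
    generalize c 0 = A at hc hodd
    generalize c 1 = B at hc hodd
    rcases Int.even_or_odd' B with ⟨k, rfl | rfl⟩
    · exfalso
      have hA : Odd A := by
        rcases hodd with h | h
        · exact h
        · exact absurd h (by simp)
      obtain ⟨l, rfl⟩ := hA
      have h5 : (th : Z3) * ((th ^ l * u ^ k : Z3ˣ) : Z3) ^ 2 =
          ((th ^ (2 * l + 1) * u ^ (2 * k) : Z3ˣ) : Z3) := by
        rw [← Units.val_pow_eq_pow_val, ← Units.val_mul]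
        congr 1
        rw [mul_pow, zpow_add, zpow_one, zpow_mul', zpow_mul', zpow_ofNat, zpow_ofNat]
        simp only [mul_assoc, mul_left_comm, mul_comm]
      rw [← h5] at hc
      have h6 : (th : Z3) = (th : Z3) * ((th ^ l * u ^ k : Z3ˣ) : Z3) ^ 2 * (((th ^ l * u ^ k)⁻¹ : Z3ˣ) : Z3) ^ 2 := by
        rw [mul_assoc, ← mul_pow, Units.mul_inv]; simp
      rcases hc with h | h
      · rw [h, one_mul] at h6
        exact (th_not_sq _).1 h6
      · rw [h, neg_one_mul] at h6
        exact (th_not_sq _).2 h6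
    · rcases Int.even_or_odd' A with ⟨l, rfl | rfl⟩
      · have h5 : ((th ^ (2 * l) * u ^ (2 * k + 1) : Z3ˣ) : Z3) =
            (u : Z3) * ((th ^ l * u ^ k : Z3ˣ) : Z3) ^ 2 := by
          rw [← Units.val_pow_eq_pow_val, ← Units.val_mul]
          congr 1
          rw [mul_pow, zpow_add, zpow_one, zpow_mul', zpow_mul', zpow_ofNat, zpow_ofNat]
          simp only [mul_assoc, mul_left_comm, mul_comm]
        rw [h5] at hc
        refine ⟨(((th ^ l * u ^ k)⁻¹ : Z3ˣ) : Z3), ?_⟩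
        have h6 : (u : Z3) = (u : Z3) * ((th ^ l * u ^ k : Z3ˣ) : Z3) ^ 2 * (((th ^ l * u ^ k)⁻¹ : Z3ˣ) : Z3) ^ 2 := by
          rw [mul_assoc, ← mul_pow, Units.mul_inv]; simp
        rcases hc with h | h
        · rw [h, one_mul] at h6
          exact Or.inl h6
        · rw [h, neg_one_mul] at h6
          exact Or.inr (Or.inl h6)
      · have h5 : ((th ^ (2 * l + 1) * u ^ (2 * k + 1) : Z3ˣ) : Z3) * (th : Z3) =
            (u : Z3) * ((th ^ (l + 1) * u ^ k : Z3ˣ) : Z3) ^ 2 := by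
          rw [← Units.val_pow_eq_pow_val, ← Units.val_mul, ← Units.val_mul]
          congr 1
          rw [mul_pow, zpow_add, zpow_add, zpow_add, zpow_one, zpow_one, zpow_mul', zpow_mul', zpow_ofNat, zpow_ofNat, mul_pow, sq th]
          simp only [mul_assoc, mul_left_comm, mul_comm]
        refine ⟨(((th ^ (l + 1) * u ^ k)⁻¹ : Z3ˣ) : Z3), ?_⟩
        have h6 : (u : Z3) = (u : Z3) * ((th ^ (l + 1) * u ^ k : Z3ˣ) : Z3) ^ 2 * (((th ^ (l + 1) * u ^ k)⁻¹ : Z3ˣ) : Z3) ^ 2 := by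
          rw [mul_assoc, ← mul_pow, Units.mul_inv]; simp
        rw [← h5] at h6
        rcases hc with h | h
        · rw [h, one_mul] at h6
          exact Or.inr (Or.inr (Or.inl h6))
        · rw [h, neg_one_mul, neg_mul] at h6
          exact Or.inr (Or.inr (Or.inr h6))

open Polynomial in
theorem good : Good := by
  have hdeg : (X ^ 3 - X + 1 : ℚ[X]).natDegree = 3 := by compute_degree!
  obtain ⟨r, hr⟩ : ∃ r : ℝ, r ^ 3 - r + 1 = 0 := by
    have hc : ContinuousOn (fun r : ℝ => r ^ 3 - r + 1) (Set.Icc (-2) 0) := by fun_prop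
    obtain ⟨r, -, hr⟩ := intermediate_value_Icc (by norm_num) hc
      (show (0 : ℝ) ∈ _ by constructor <;> norm_num)
    exact ⟨r, hr⟩
  obtain ⟨L, _, _, t, ht, hfin, hext, hlin, hb, ⟨φ⟩⟩ := adjoin_facts _ cubic_irr r (by simpa using hr)
  rw [hdeg] at hb
  obtain ⟨b, hb⟩ := hb
  have ht' : t ^ 3 - t + 1 = 0 := by simpa using ht
  refine good_of_field t (by linear_combination ht') b hb ?_ φ
  intro p q r h
  have := hlin (C (p : ℚ) + C (q : ℚ) * X + C (r : ℚ) * X ^ 2) (by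
    rw [hdeg]
    have : (C (p : ℚ) + C (q : ℚ) * X + C (r : ℚ) * X ^ 2).natDegree ≤ 2 := by
      compute_degree!
    omega) (by
    simp only [eval₂_add, eval₂_mul, eval₂_C, eval₂_X, eval₂_pow]
    simp only [map_intCast]
    exact h)
  have e0 := congrArg (fun p : ℚ[X] => p.coeff 0) this
  have e1 := congrArg (fun p : ℚ[X] => p.coeff 1) this
  have e2 := congrArg (fun p : ℚ[X] => p.coeff 2) this
  simp only [coeff_add, coeff_C_mul, coeff_X_pow, coeff_X, coeff_C] at e0 e1 e2
  norm_num at e0 e1 e2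
  exact ⟨e0, e1, e2⟩

end Z3
namespace Qr

theorem table_cd : ∀ i : Fin 16, ∀ j : Fin 16, ((eps : Qr) ^ (i : ℕ) * (w : Qr) ^ (j : ℕ)).c % 16 = 0 →
    ((eps : Qr) ^ (i : ℕ) * (w : Qr) ^ (j : ℕ)).d % 16 = 0 → (i = 0 ∨ i = 1) ∧ j = 0 := by
  decide +kernel

theorem table_ad : ∀ i : Fin 16, ∀ j : Fin 16, ((eps : Qr) ^ (i : ℕ) * (w : Qr) ^ (j : ℕ)).a % 16 = 0 →
    ((eps : Qr) ^ (i : ℕ) * (w : Qr) ^ (j : ℕ)).d % 16 = 0 →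
      i = 0 ∧ (j = 1 ∨ j = 7 ∨ j = 9 ∨ j = 15) := by
  decide +kernel

theorem unit_mod16 (s v : Qrˣ) (x : Qr) (hs : (s : Qr) = 1 ∨ (s : Qr) = -1) :
    ∃ t : Qr, (s : Qr) * x * (v : Qr) ^ 2 ^ 4 = s * x + ((16 : ℤ) : Qr) * t := by
  obtain ⟨t, ht⟩ := pow_mod v 3
  refine ⟨s * x * t, ?_⟩
  rw [show 2 ^ 4 = 2 ^ (3 + 1) by norm_num, ht]
  push_cast
  ring

theorem unit_cd (H : Gen) (u : Qrˣ) (hc : (u : Qr).c = 0) (hd : (u : Qr).d = 0) :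
    (u : Qr) = 1 ∨ (u : Qr) = -1 ∨ (u : Qr) = eps ∨ (u : Qr) = -eps := by
  obtain ⟨s, i, j, v, -, hs', hi, hj, hu⟩ := gen_pow H 4 u
  obtain ⟨t, ht⟩ := unit_mod16 s v ((eps : Qr) ^ i * (w : Qr) ^ j) hs'
  have hu' : (u : Qr) = s * ((eps : Qr) ^ i * (w : Qr) ^ j) + ((16 : ℤ) : Qr) * t := by
    rw [← ht, hu]; push_cast; ring
  have hT := table_cd ⟨i, hi⟩ ⟨j, hj⟩
  simp only [Fin.mk_eq_zero, Fin.mk_eq_one] at hT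
  generalize (eps : Qr) ^ i * (w : Qr) ^ j = X at hu' hT
  rw [hu'] at hc hd
  have hT' : (i = 0 ∨ i = 1) ∧ j = 0 := by
    have := hT (by
      rcases hs' with h | h <;> rw [h] at hc <;>
      simp only [mul_c, add_c, one_a, one_b, one_c, one_d, neg_a, neg_b, neg_c, neg_d,
        intCast_a, intCast_b, intCast_c, intCast_d] at hc <;> omega) (by
      rcases hs' with h | h <;> rw [h] at hd <;>
      simp only [mul_d, add_d, one_a, one_b, one_c, one_d, neg_a, neg_b, neg_c, neg_d,
        intCast_a, intCast_b, intCast_c, intCast_d] at hd <;> omega)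
    refine ⟨?_, ?_⟩
    · rcases this.1 with h | h
      · left; simpa [Fin.ext_iff] using h
      · right; simpa [Fin.ext_iff] using h
    · simpa [Fin.ext_iff] using this.2
  rw [← hu'] at hc hd
  obtain ⟨hi0, rfl⟩ := hT'
  have hdes : u = s * eps ^ i := by
    refine descent H u (s * eps ^ i) (v ^ 2) ?_ ?_
    · rw [hu, pow_zero, mul_one, ← pow_mul]; norm_num
    · intro k I J t h
      rw [h] at hc hd
      have hP : (2 : ℤ) ^ (k + 3) ≠ 0 := by positivity
      generalize (2 : ℤ) ^ (k + 3) = P at hc hd hP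
      rcases hi0 with rfl | rfl <;> rcases hs' with h | h <;>
      simp only [pow_zero, pow_one, mul_one, Units.val_mul, h, eps,
        mul_a, mul_b, mul_c, mul_d, add_a, add_b, add_c, add_d, one_a, one_b, one_c, one_d,
        neg_a, neg_b, neg_c, neg_d,
        intCast_a, intCast_b, intCast_c, intCast_d] at hc hd
      · have h1 : 3 * I + 2 * J + 4 * t.c = 0 := by
          apply mul_left_cancel₀ hP; linear_combination hc
        have h2 : 3 * J + 4 * t.d = 0 := by
          apply mul_left_cancel₀ hP; linear_combination hd
        omega
      · have h1 : 3 * I + 2 * J + 4 * t.c = 0 := by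
          apply mul_left_cancel₀ hP; linear_combination -hc
        have h2 : 3 * J + 4 * t.d = 0 := by
          apply mul_left_cancel₀ hP; linear_combination -hd
        omega
      · have h1 : 3 * I + 2 * J + 4 * t.c - 2 * (3 * I + 4 * t.b) = 0 := by
          apply mul_left_cancel₀ hP; linear_combination hc
        have h2 : 3 * J + 4 * t.d - (3 * I + 2 * J + 4 * t.c) - 4 * (3 * J + 4 * t.d) = 0 := by
          apply mul_left_cancel₀ hP; linear_combination hd
        omega
      · have h1 : 3 * I + 2 * J + 4 * t.c - 2 * (3 * I + 4 * t.b) = 0 := by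
          apply mul_left_cancel₀ hP; linear_combination -hc
        have h2 : 3 * J + 4 * t.d - (3 * I + 2 * J + 4 * t.c) - 4 * (3 * J + 4 * t.d) = 0 := by
          apply mul_left_cancel₀ hP; linear_combination -hd
        omega
  rw [hdes]
  rcases hi0 with rfl | rfl <;> rcases hs' with h | h <;> simp [h]

theorem unit_ad (H : Gen) (u : Qrˣ) (hc : (u : Qr).a = 0) (hd : (u : Qr).d = 0) :
    (u : Qr) = w ∨ (u : Qr) = -w ∨ (u : Qr) = (w⁻¹ : Qrˣ) ∨ (u : Qr) = -(w⁻¹ : Qrˣ) := by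
  obtain ⟨s, i, j, v, -, hs', hi, hj, hu⟩ := gen_pow H 4 u
  obtain ⟨t, ht⟩ := unit_mod16 s v ((eps : Qr) ^ i * (w : Qr) ^ j) hs'
  have hu' : (u : Qr) = s * ((eps : Qr) ^ i * (w : Qr) ^ j) + ((16 : ℤ) : Qr) * t := by
    rw [← ht, hu]; push_cast; ring
  have hT := table_ad ⟨i, hi⟩ ⟨j, hj⟩
  generalize (eps : Qr) ^ i * (w : Qr) ^ j = X at hu' hT
  rw [hu'] at hc hd
  have hT' : i = 0 ∧ (j = 1 ∨ j = 7 ∨ j = 9 ∨ j = 15) := by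
    have := hT (by
      rcases hs' with h | h <;> rw [h] at hc <;>
      simp only [mul_a, add_a, one_a, one_b, one_c, one_d, neg_a, neg_b, neg_c, neg_d,
        intCast_a, intCast_b, intCast_c, intCast_d] at hc <;> omega) (by
      rcases hs' with h | h <;> rw [h] at hd <;>
      simp only [mul_d, add_d, one_a, one_b, one_c, one_d, neg_a, neg_b, neg_c, neg_d,
        intCast_a, intCast_b, intCast_c, intCast_d] at hd <;> omega)
    simpa [Fin.ext_iff] using this
  rw [← hu'] at hc hd
  obtain ⟨rfl, hj0⟩ := hT'
  have hv : ∃ v' : Qrˣ, u = s * w * v' ^ 2 ^ 3 ∨ u = s * w⁻¹ * v' ^ 2 ^ 3 := by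
    rw [hu, pow_zero, mul_one]
    rcases hj0 with rfl | rfl | rfl | rfl
    · exact ⟨v ^ 2, Or.inl (by rw [← pow_mul]; norm_num)⟩
    · refine ⟨w * v ^ 2, Or.inr ?_⟩
      rw [mul_pow, ← pow_mul, show 2 * 2 ^ 3 = 2 ^ 4 by norm_num, mul_assoc s, mul_assoc s,
        mul_right_inj, eq_inv_mul_iff_mul_eq, ← mul_assoc, ← pow_succ' w 7, show 7 + 1 = 2 ^ 3 by norm_num]
    · refine ⟨w * v ^ 2, Or.inl ?_⟩
      rw [mul_pow, ← pow_mul, show 2 * 2 ^ 3 = 2 ^ 4 by norm_num, show 9 = 1 + 2 ^ 3 by norm_num, pow_add, pow_one]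
      simp only [mul_assoc]
    · refine ⟨w ^ 2 * v ^ 2, Or.inr ?_⟩
      rw [mul_pow, ← pow_mul, ← pow_mul, show 2 * 2 ^ 3 = 2 ^ 4 by norm_num, mul_assoc s,
        mul_assoc s, mul_right_inj, eq_inv_mul_iff_mul_eq, ← mul_assoc, ← pow_succ' w 15, show 15 + 1 = 2 ^ 4 by norm_num]
  obtain ⟨v', hv' | hv'⟩ := hv
  · have hdes : u = s * w := by
      refine descent H u (s * w) v' hv' ?_
      intro k I J t h
      rw [h] at hc hd
      have hP : (2 : ℤ) ^ (k + 3) ≠ 0 := by positivity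
      generalize (2 : ℤ) ^ (k + 3) = P at hc hd hP
      rcases hs' with h | h <;>
      simp only [Units.val_mul, h, w,
        mul_a, mul_b, mul_c, mul_d, add_a, add_b, add_c, add_d, one_a, one_b, one_c, one_d,
        neg_a, neg_b, neg_c, neg_d,
        intCast_a, intCast_b, intCast_c, intCast_d] at hc hd
      · have h1 : -(3 * I + 2 * J + 4 * t.c) - 4 * (3 * J + 4 * t.d) = 0 := by
          apply mul_left_cancel₀ hP; linear_combination hc
        have h2 : (3 * I + 4 * t.b) + 2 * (3 * I + 2 * J + 4 * t.c) + 8 * (3 * J + 4 * t.d) = 0 := by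
          apply mul_left_cancel₀ hP; linear_combination hd
        omega
      · have h1 : -(3 * I + 2 * J + 4 * t.c) - 4 * (3 * J + 4 * t.d) = 0 := by
          apply mul_left_cancel₀ hP; linear_combination -hc
        have h2 : (3 * I + 4 * t.b) + 2 * (3 * I + 2 * J + 4 * t.c) + 8 * (3 * J + 4 * t.d) = 0 := by
          apply mul_left_cancel₀ hP; linear_combination -hd
        omega
    rw [hdes]
    rcases hs' with h | h <;> simp [h]
  · have hdes : u = s * w⁻¹ := by
      refine descent H u (s * w⁻¹) v' hv' ?_
      intro k I J t h
      rw [h] at hc hd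
      have hP : (2 : ℤ) ^ (k + 3) ≠ 0 := by positivity
      generalize (2 : ℤ) ^ (k + 3) = P at hc hd hP
      have hw : ((w⁻¹ : Qrˣ) : Qr) = ⟨0, 2, -1, 0⟩ := rfl
      rcases hs' with h | h <;>
      simp only [Units.val_mul, h, hw,
        mul_a, mul_b, mul_c, mul_d, add_a, add_b, add_c, add_d, one_a, one_b, one_c, one_d,
        neg_a, neg_b, neg_c, neg_d,
        intCast_a, intCast_b, intCast_c, intCast_d] at hc hd
      · have h1 : (3 * I + 2 * J + 4 * t.c) = 0 := by
          apply mul_left_cancel₀ hP; linear_combination hc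
        have h2 : -(3 * I + 4 * t.b) = 0 := by
          apply mul_left_cancel₀ hP; linear_combination hd
        omega
      · have h1 : (3 * I + 2 * J + 4 * t.c) = 0 := by
          apply mul_left_cancel₀ hP; linear_combination -hc
        have h2 : -(3 * I + 4 * t.b) = 0 := by
          apply mul_left_cancel₀ hP; linear_combination -hd
        omega
    rw [hdes]
    rcases hs' with h | h <;> simp [h]

theorem thue_two (H : Gen) (m n : ℤ) (h : m ^ 4 - 4 * m ^ 3 * n + 4 * n ^ 4 = 1) :
    (m = 1 ∧ n = 0) ∨ (m = -1 ∧ n = 0) ∨ (m = 1 ∧ n = 1) ∨ (m = -1 ∧ n = -1) := by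
  have hu : (⟨m, -n, 0, 0⟩ : Qr) * ⟨m ^ 3 - 4 * m ^ 2 * n, m ^ 2 * n - 4 * m * n ^ 2,
      2 * m * n ^ 2 - 8 * n ^ 3, 2 * n ^ 3⟩ = 1 := by
    ext <;> simp only [mul_a, mul_b, mul_c, mul_d, one_a, one_b, one_c, one_d]
    · linear_combination h
    all_goals ring
  have := unit_cd H (Units.mkOfMulEqOne _ _ hu) rfl rfl
  simp only [Units.val_mkOfMulEqOne, Qr.ext_iff, eps, one_a, one_b, one_c, one_d, neg_a, neg_b, neg_c, neg_d] at this
  omega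

theorem thue_one (H : Gen) (m n : ℤ) (h : n ^ 4 - 8 * m ^ 3 * n + 4 * m ^ 4 = 1) :
    (n = 1 ∧ m = 0) ∨ (n = -1 ∧ m = 0) ∨ (n = 1 ∧ m = 2) ∨ (n = -1 ∧ m = -2) := by
  have hu : (⟨0, -m, n, 0⟩ : Qr) * (⟨n ^ 3, 4 * n * m ^ 2 - 2 * m ^ 3, 4 * n ^ 2 * m - 2 * n * m ^ 2,
      - n ^ 2 * m⟩ * ⟨0, 2, -1, 0⟩) = 1 := by
    ext <;> simp only [mul_a, mul_b, mul_c, mul_d, one_a, one_b, one_c, one_d]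
    · linear_combination h
    all_goals ring
  have := unit_ad H (Units.mkOfMulEqOne _ _ hu) rfl rfl
  have hw : ((w⁻¹ : Qrˣ) : Qr) = ⟨0, 2, -1, 0⟩ := rfl
  have hw' : (w : Qr) = ⟨0, 0, 1, 0⟩ := rfl
  rw [hw, hw'] at this
  simp only [Units.val_mkOfMulEqOne, Qr.ext_iff, one_a, one_b, one_c, one_d, neg_a, neg_b, neg_c, neg_d] at this
  omega
end Qr

namespace Z3

theorem norm_unit (x : Z3) (h : IsUnit (norm x)) : IsUnit x := by
  have hx : x * ⟨(x.a + x.c) ^ 2 - x.b * (x.b - x.c), -x.a * x.b - x.c ^ 2,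
      x.b ^ 2 - x.c * (x.a + x.c)⟩ = ((norm x : ℤ) : Z3) := by
    rw [norm_apply]
    ext <;> simp only [mul_a, mul_b, mul_c, intCast_a, intCast_b, intCast_c] <;> ring
  have h2 : IsUnit ((norm x : ℤ) : Z3) := h.map (Int.castRingHom Z3)
  rw [← hx] at h2
  exact isUnit_of_mul_isUnit_left h2

theorem no_sq23 (y n : ℤ) (h : y ^ 2 = 23 * n ^ 2) : y = 0 := by
  by_cases hn : n = 0
  · subst hn; simpa using h
  · exfalso
    have h1 : IsSquare ((23 : ℤ) : ℚ) := by
      refine ⟨(y : ℚ) / n, ?_⟩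
      have hn' : (n : ℚ) ≠ 0 := by exact_mod_cast hn
      field_simp
      exact_mod_cast h.symm
    rw [Rat.isSquare_intCast_iff] at h1
    obtain ⟨k, hk⟩ := h1
    have h2 : k < 5 := by nlinarith
    have h3 : -5 < k := by nlinarith
    interval_cases k <;> omega

theorem factor (x y : ℤ) (h : y ^ 2 = x ^ 3 - x + 1) :
    ∃ s : Z3, (⟨x, -1, 0⟩ : Z3) = s ^ 2 ∨ (⟨x, -1, 0⟩ : Z3) = -(th * s ^ 2) := by
  obtain ⟨hdom, hPID, hunits⟩ := good
  have : NoZeroDivisors Z3 := ⟨fun {a b} hab => hdom a b hab⟩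
  have : Nontrivial Z3 := ⟨0, 1, fun h => by simpa using congrArg Z3.a h⟩
  have : IsDomain Z3 := NoZeroDivisors.to_isDomain Z3
  have hy : y ≠ 0 := by
    rintro rfl
    have h1 : x * ((x - 1) * (x + 1)) = -1 := by linear_combination -h
    have h2 : IsUnit x := IsUnit.of_mul_eq_one (-((x - 1) * (x + 1))) (by linear_combination -h1)
    rcases Int.isUnit_iff.mp h2 with rfl | rfl <;> norm_num at h1
  set X : Z3 := ⟨x, -1, 0⟩ with hX
  set q : Z3 := ⟨x ^ 2 - 1, x, 1⟩ with hq
  have hprod : X * q = ((y : ℤ) : Z3) ^ 2 := by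
    rw [sq, hX, hq]
    ext <;> simp only [mul_a, mul_b, mul_c, intCast_a, intCast_b, intCast_c]
    · linear_combination -h
    · ring
    · ring
  have hnX : norm X = y ^ 2 := by
    rw [norm_apply, hX, h]; ring
  obtain ⟨D, hD⟩ := (IsPrincipalIdealRing.principal (Ideal.span {X, q})).principal
  have hXD : D ∣ X := by
    rw [← Ideal.mem_span_singleton]
    change X ∈ Submodule.span Z3 {D}
    rw [← hD]; exact Ideal.subset_span (by simp)
  have hqD : D ∣ q := by
    rw [← Ideal.mem_span_singleton]
    change q ∈ Submodule.span Z3 {D}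
    rw [← hD]; exact Ideal.subset_span (by simp)
  obtain ⟨α, β, hαβ⟩ : ∃ α β, α * X + β * q = D := by
    rw [← Ideal.mem_span_pair, hD]; exact Submodule.mem_span_singleton_self D
  have hdel : D ∣ (⟨-1, 0, 3⟩ : Z3) := by
    have e : (⟨-1, 0, 3⟩ : Z3) = q + X * (-⟨x, 2, 0⟩) := by
      rw [hX, hq]
      ext <;> simp only [add_a, add_b, add_c, mul_a, mul_b, mul_c, neg_a, neg_b, neg_c] <;> ring
    rw [e]
    exact hqD.add (hXD.mul_right _)
  have hN : norm D ∣ 23 := by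
    have := map_dvd norm hdel
    rwa [show norm ⟨-1, 0, 3⟩ = 23 by rw [norm_apply]; norm_num] at this
  have hunitN : ∀ u : Z3ˣ, norm (u : Z3) = 1 ∨ norm (u : Z3) = -1 := fun u =>
    Int.isUnit_iff.mp (u.isUnit.map norm)
  have hcase : IsUnit (norm D) ∨ norm D = 23 ∨ norm D = -23 := by
    obtain ⟨k, hk⟩ := hN
    have hp : Irreducible (23 : ℤ) := (Int.prime_iff_natAbs_prime.mpr (by norm_num)).irreducible
    rcases hp.isUnit_or_isUnit hk with h | h
    · exact Or.inl h
    · right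
      rcases Int.isUnit_iff.mp h with rfl | rfl
      · left; linarith
      · right; linarith
  rcases hcase with hu | hbad
  · have hDu : IsUnit D := norm_unit D hu
    have hcop : IsCoprime X q := by
      obtain ⟨i, hi⟩ := hDu.exists_left_inv
      exact ⟨i * α, i * β, by rw [← hi, ← hαβ]; ring⟩
    obtain ⟨d, u, hd⟩ := exists_associated_pow_of_mul_eq_pow' hcop hprod
    have hneg : ∀ z : Z3, norm (-z) = - norm z := by
      intro z; simp only [norm_apply, neg_a, neg_b, neg_c]; ring
    have hth : norm (th : Z3) = -1 := by rw [norm_apply]; simp [th]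
    have hbad : ∀ n : ℤ, y ^ 2 ≠ -n ^ 2 := by
      intro n hn
      have : 0 < y ^ 2 := by positivity
      nlinarith [sq_nonneg n]
    obtain ⟨v, hv | hv | hv | hv⟩ := hunits u
    · exact ⟨d * v, Or.inl (by rw [← hd, hv]; ring)⟩
    · exfalso
      apply hbad (norm (d * v))
      rw [← hnX, ← map_pow, ← hneg, ← hd, hv]
      congr 1; ring
    · exfalso
      apply hbad (norm (d * v))
      rw [← hnX, ← map_pow, ← hd, hv, ← neg_one_mul, ← hth, ← map_mul]
      congr 1; ring
    · exact ⟨d * v, Or.inr (by rw [← hd, hv]; ring)⟩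
  · exfalso
    have hD0 : D ≠ 0 := by
      rintro rfl
      rw [norm_apply] at hbad
      simp at hbad
    obtain ⟨A, hA⟩ := hXD
    obtain ⟨B, hB⟩ := hqD
    have hcop : IsCoprime A B := by
      refine ⟨α, β, ?_⟩
      apply mul_left_cancel₀ hD0
      rw [mul_one]
      conv_rhs => rw [← hαβ, hA, hB]
      ring
    have hdvd : D ^ 2 ∣ ((y : ℤ) : Z3) ^ 2 := ⟨A * B, by rw [← hprod, hA, hB]; ring⟩
    have hdvd2 : D ∣ ((y : ℤ) : Z3) := by
      have : IsIntegrallyClosed Z3 := by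
        have : UniqueFactorizationMonoid Z3 := inferInstance
        infer_instance
      exact (IsIntegrallyClosed.pow_dvd_pow_iff two_ne_zero).mp hdvd
    obtain ⟨E, hE⟩ := hdvd2
    have hAB : A * B = E ^ 2 := by
      apply mul_left_cancel₀ (pow_ne_zero 2 hD0)
      rw [← mul_pow, ← hE, ← hprod, hA, hB]; ring
    obtain ⟨d, u, hd⟩ := exists_associated_pow_of_mul_eq_pow' hcop hAB
    have h1 : y ^ 2 = norm D * (norm d ^ 2 * norm (u : Z3)) := by
      rw [← hnX, hA, ← hd, map_mul, map_mul, map_pow]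
    have hpos : 0 < y ^ 2 := by positivity
    rcases hbad with h2 | h2 <;> rcases hunitN u with h3 | h3 <;> rw [h2, h3] at h1
    · exact hy (no_sq23 y (norm d) (by linarith))
    · nlinarith [sq_nonneg (norm d)]
    · nlinarith [sq_nonneg (norm d)]
    · exact hy (no_sq23 y (norm d) (by linarith))

end Z3

theorem sqpair (p q e : ℤ) (hc : IsCoprime p q) (h : p * q = e ^ 2) :
    ∃ m n : ℤ, (p = m ^ 2 ∧ q = n ^ 2 ∧ e = m * n) ∨ (p = -m ^ 2 ∧ q = -n ^ 2 ∧ e = -(m * n)) := by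
  obtain ⟨m, hm⟩ := Int.sq_of_isCoprime hc h
  obtain ⟨n, hn⟩ := Int.sq_of_isCoprime hc.symm (by rw [mul_comm]; exact h)
  have hs : ∀ t : ℤ, e ^ 2 = (m * t) ^ 2 → e = m * t ∨ e = -(m * t) := fun t ht =>
    sq_eq_sq_iff_eq_or_eq_neg.mp ht
  rcases hm with hm | hm <;> rcases hn with hn | hn
  · rcases hs n (by rw [← h, hm, hn]; ring) with h1 | h1
    · exact ⟨m, n, Or.inl ⟨hm, hn, h1⟩⟩
    · exact ⟨m, -n, Or.inl ⟨hm, by rw [hn]; ring, by rw [h1]; ring⟩⟩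
  · have h0 : e ^ 2 + (m * n) ^ 2 = 0 := by rw [← h, hm, hn]; ring
    have he : e = 0 := by
      have : e ^ 2 = 0 := by nlinarith [sq_nonneg e, sq_nonneg (m * n)]
      simpa using this
    have hmn : m * n = 0 := by
      have : (m * n) ^ 2 = 0 := by nlinarith [sq_nonneg e, sq_nonneg (m * n)]
      simpa using this
    rcases mul_eq_zero.mp hmn with h1 | h1
    · exact ⟨m, n, Or.inr ⟨by rw [hm, h1]; ring, hn, by rw [he, hmn]; ring⟩⟩
    · exact ⟨m, n, Or.inl ⟨hm, by rw [hn, h1]; ring, by rw [he, hmn]⟩⟩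
  · have h0 : e ^ 2 + (m * n) ^ 2 = 0 := by rw [← h, hm, hn]; ring
    have he : e = 0 := by
      have : e ^ 2 = 0 := by nlinarith [sq_nonneg e, sq_nonneg (m * n)]
      simpa using this
    have hmn : m * n = 0 := by
      have : (m * n) ^ 2 = 0 := by nlinarith [sq_nonneg e, sq_nonneg (m * n)]
      simpa using this
    rcases mul_eq_zero.mp hmn with h1 | h1
    · exact ⟨m, n, Or.inl ⟨by rw [hm, h1]; ring, hn, by rw [he, hmn]⟩⟩
    · exact ⟨m, n, Or.inr ⟨hm, by rw [hn, h1]; ring, by rw [he, hmn]; ring⟩⟩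
  · rcases hs n (by rw [← h, hm, hn]; ring) with h1 | h1
    · exact ⟨m, -n, Or.inr ⟨hm, by rw [hn]; ring, by rw [h1]; ring⟩⟩
    · exact ⟨m, n, Or.inr ⟨hm, hn, h1⟩⟩

theorem case_one (x a b c : ℤ) (h1 : x = a ^ 2 - 2 * b * c)
    (h2 : 2 * a * b + 2 * b * c - c ^ 2 = -1) (h3 : b ^ 2 + 2 * a * c + c ^ 2 = 0) :
    x = -1 ∨ x = 3 := by
  have hc : IsCoprime (-c) (2 * a + c) := ⟨b - c, -b, by linear_combination -h2⟩
  obtain ⟨m, n, ⟨hp, hq, he⟩ | ⟨hp, hq, he⟩⟩ := sqpair (-c) (2 * a + c) b hc (by linear_combination -h3)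
  · have hcm : c = -m ^ 2 := by linarith
    have ha : 2 * a = n ^ 2 + m ^ 2 := by linarith
    subst hcm he
    have key : m * (m ^ 3 + m ^ 2 * n - n ^ 3) = 1 := by
      linear_combination -h2 + m * n * ha
    have hm : m = 1 ∨ m = -1 := Int.isUnit_iff.mp (IsUnit.of_mul_eq_one _ key)
    have hx : 4 * x = (n ^ 2 + m ^ 2) ^ 2 + 8 * m ^ 3 * n := by
      rw [h1, ← ha]; ring
    rcases hm with rfl | rfl
    · have : n * ((n - 1) * (n + 1)) = 0 := by linear_combination -key
      rcases mul_eq_zero.mp this with h | h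
      · subst h; omega
      · rcases mul_eq_zero.mp h with h | h
        · have : n = 1 := by omega
          subst this; omega
        · have : n = -1 := by omega
          subst this; omega
    · have : n * ((n - 1) * (n + 1)) = 0 := by linear_combination key
      rcases mul_eq_zero.mp this with h | h
      · subst h; omega
      · rcases mul_eq_zero.mp h with h | h
        · have : n = 1 := by omega
          subst this; omega
        · have : n = -1 := by omega
          subst this; omega
  · have hcm : c = m ^ 2 := by linarith
    have ha : 2 * a = -n ^ 2 - m ^ 2 := by linarith
    subst hcm he
    have key : m * (m ^ 3 + m ^ 2 * n - n ^ 3) = 1 := by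
      linear_combination -h2 - m * n * ha
    have hm : m = 1 ∨ m = -1 := Int.isUnit_iff.mp (IsUnit.of_mul_eq_one _ key)
    have hx : 4 * x = (n ^ 2 + m ^ 2) ^ 2 + 8 * m ^ 3 * n := by
      have : (n ^ 2 + m ^ 2) ^ 2 = (2 * a) ^ 2 := by rw [ha]; ring
      rw [this, h1]; ring
    rcases hm with rfl | rfl
    · have : n * ((n - 1) * (n + 1)) = 0 := by linear_combination -key
      rcases mul_eq_zero.mp this with h | h
      · subst h; omega
      · rcases mul_eq_zero.mp h with h | h
        · have : n = 1 := by omega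
          subst this; omega
        · have : n = -1 := by omega
          subst this; omega
    · have : n * ((n - 1) * (n + 1)) = 0 := by linear_combination key
      rcases mul_eq_zero.mp this with h | h
      · subst h; omega
      · rcases mul_eq_zero.mp h with h | h
        · have : n = 1 := by omega
          subst this; omega
        · have : n = -1 := by omega
          subst this; omega

theorem case_two (x b c d : ℤ) (h1 : c ^ 2 = 2 * b * d) (h2 : d ^ 2 + b ^ 2 - 2 * b * c = 1)
    (hx : x = b ^ 2 + 2 * c * d - c ^ 2) : x = 0 ∨ x = 56 ∨ x = 1 ∨ x = 5 := by
  have hce : 2 ∣ c := by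
    apply Int.prime_two.dvd_of_dvd_pow (n := 2)
    exact ⟨b * d, by rw [h1]; ring⟩
  obtain ⟨e, rfl⟩ := hce
  have h3 : b * d = 2 * e ^ 2 := by
    have : 2 * (b * d) = 2 * (2 * e ^ 2) := by linear_combination -h1
    linarith
  have hdv : 2 ∣ b ∨ 2 ∣ d := Int.prime_two.dvd_or_dvd ⟨e ^ 2, h3⟩
  rcases hdv with ⟨b', rfl⟩ | ⟨d', rfl⟩
  · have hc : IsCoprime b' d := ⟨4 * b' - 8 * e, d, by linear_combination h2⟩
    obtain ⟨m, n, ⟨rfl, rfl, rfl⟩ | ⟨rfl, rfl, rfl⟩⟩ := sqpair b' d e hc (by linarith) <;>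
    · have ht : n ^ 4 - 8 * m ^ 3 * n + 4 * m ^ 4 = 1 := by linear_combination h2
      rcases Qr.thue_one gen_true m n ht with ⟨rfl, rfl⟩ | ⟨rfl, rfl⟩ | ⟨rfl, rfl⟩ | ⟨rfl, rfl⟩ <;>
        norm_num at hx <;> simp [hx]
  · have hc : IsCoprime b d' := ⟨b - 4 * e, 4 * d', by linear_combination h2⟩
    obtain ⟨m, n, ⟨rfl, rfl, rfl⟩ | ⟨rfl, rfl, rfl⟩⟩ := sqpair b d' e hc (by linarith) <;>
    · have ht : m ^ 4 - 4 * m ^ 3 * n + 4 * n ^ 4 = 1 := by linear_combination h2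
      rcases Qr.thue_two gen_true m n ht with ⟨rfl, rfl⟩ | ⟨rfl, rfl⟩ | ⟨rfl, rfl⟩ | ⟨rfl, rfl⟩ <;>
        norm_num at hx <;> simp [hx]

theorem x_values (x y : ℤ) (h : y ^ 2 = x ^ 3 - x + 1) :
    x = -1 ∨ x = 3 ∨ x = 0 ∨ x = 56 ∨ x = 1 ∨ x = 5 := by
  obtain ⟨⟨a, b, c⟩, hs | hs⟩ := Z3.factor x y h
  · rw [pow_two, Z3.ext_iff] at hs
    simp only [Z3.mul_a, Z3.mul_b, Z3.mul_c] at hs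
    obtain ⟨e1, e2, e3⟩ := hs
    have := case_one x a b c (by linear_combination e1) (by linear_combination -e2)
      (by linear_combination -e3)
    tauto
  · rw [pow_two, Z3.ext_iff] at hs
    simp only [Z3.mul_a, Z3.mul_b, Z3.mul_c, Z3.neg_a, Z3.neg_b, Z3.neg_c, Z3.th] at hs
    obtain ⟨e1, e2, e3⟩ := hs
    have f1 : c ^ 2 = 2 * b * (a + c) := by linear_combination -e3
    have := case_two x b c (a + c) f1 (by linear_combination e2)
      (by linear_combination e1)
    tauto

theorem stmt_7 (x y : ℤ) :
    y ^ 2 = x ^ 3 - x + 1 ↔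
      (x, y) ∈ ({(0, 1), (0, -1), (1, 1), (1, -1), (-1, 1), (-1, -1),
        (3, 5), (3, -5), (5, 11), (5, -11), (56, 419), (56, -419)} : Set (ℤ × ℤ)) := by
  simp only [Set.mem_insert_iff, Set.mem_singleton_iff, Prod.mk.injEq]
  constructor
  · intro h
    have key : ∀ k : ℤ, y ^ 2 = k ^ 2 → y = k ∨ y = -k := fun k hk =>
      sq_eq_sq_iff_eq_or_eq_neg.mp hk
    rcases x_values x y h with rfl | rfl | rfl | rfl | rfl | rfl
    · have := key 1 (by rw [h]; norm_num)
      rcases this with rfl | rfl <;> simp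
    · have := key 5 (by rw [h]; norm_num)
      rcases this with rfl | rfl <;> simp
    · have := key 1 (by rw [h]; norm_num)
      rcases this with rfl | rfl <;> simp
    · have := key 419 (by rw [h]; norm_num)
      rcases this with rfl | rfl <;> simp
    · have := key 1 (by rw [h]; norm_num)
      rcases this with rfl | rfl <;> simp
    · have := key 11 (by rw [h]; norm_num)
      rcases this with rfl | rfl <;> simp
  · rintro (⟨rfl, rfl⟩ | ⟨rfl, rfl⟩ | ⟨rfl, rfl⟩ | ⟨rfl, rfl⟩ | ⟨rfl, rfl⟩ | ⟨rfl, rfl⟩ |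
      ⟨rfl, rfl⟩ | ⟨rfl, rfl⟩ | ⟨rfl, rfl⟩ | ⟨rfl, rfl⟩ | ⟨rfl, rfl⟩ | ⟨rfl, rfl⟩) <;> norm_num
end

section
/- The elliptic curve y^2 = x^3 - 2x^2 + 3x - 1 over ℚ has exactly two affine rational points: (1, 1) and (1, -1). -/
namespace Eis
open QuadraticAlgebra

theorem norm_eq_s11 (z : Eis) : norm z = z.re ^ 2 - z.re * z.im + z.im ^ 2 := by
  rw [norm_def]; ring

theorem norm_nonneg' (z : Eis) : 0 ≤ norm z := by
  rw [norm_eq_s11]; nlinarith [sq_nonneg (z.re - z.im), sq_nonneg (z.re), sq_nonneg z.im]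

theorem norm_pos' {z : Eis} (hz : z ≠ 0) : 0 < norm z := by
  rcases lt_or_eq_of_le (norm_nonneg' z) with h | h
  · exact h
  · exfalso
    apply hz
    rw [norm_eq_s11] at h
    have h2 : z.im = 0 := by nlinarith [sq_nonneg (2 * z.re - z.im), sq_nonneg z.im]
    have h1 : z.re = 0 := by
      rw [h2] at h
      nlinarith [sq_nonneg z.re]
    ext <;> simp [h1, h2]

theorem exists_near (P n : ℤ) (hn : 0 < n) : ∃ q : ℤ, -n ≤ 2 * (P - q * n) ∧ 2 * (P - q * n) ≤ n := by
  refine ⟨(2 * P + n) / (2 * n), ?_⟩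
  have h1 := Int.emod_add_mul_ediv (2 * P + n) (2 * n)
  have h2 := Int.emod_nonneg (2 * P + n) (show 2 * n ≠ 0 by omega)
  have h3 := Int.emod_lt_of_pos (2 * P + n) (show 0 < 2 * n by omega)
  constructor <;> nlinarith

theorem exists_div (x y : Eis) (hy : y ≠ 0) : ∃ q : Eis, norm (x - y * q) < norm y := by
  have hn := norm_pos' hy
  obtain ⟨q1, h1, h1'⟩ := exists_near (x * star y).re (norm y) hn
  obtain ⟨q2, h2, h2'⟩ := exists_near (x * star y).im (norm y) hn
  refine ⟨⟨q1, q2⟩, ?_⟩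
  have key : norm (x - y * ⟨q1, q2⟩) * norm y =
      ((x * star y).re - q1 * norm y) ^ 2 - ((x * star y).re - q1 * norm y) *
       ((x * star y).im - q2 * norm y) + ((x * star y).im - q2 * norm y) ^ 2 := by
    simp only [norm_eq_s11, re_sub, im_sub, re_mul, im_mul, re_star, im_star]
    ring
  generalize (x * star y).re - q1 * norm y = a at *
  generalize (x * star y).im - q2 * norm y = b at *
  generalize norm (x - y * ⟨q1, q2⟩) = r at *
  generalize norm y = n at *
  by_contra hc
  push Not at hc
  have e1 : 4 * a ^ 2 ≤ n ^ 2 := by nlinarith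
  have e2 : 4 * b ^ 2 ≤ n ^ 2 := by nlinarith
  nlinarith [sq_nonneg (a + b)]

theorem norm_le_mul (a : Eis) {b : Eis} (hb : b ≠ 0) : norm a ≤ norm (a * b) := by
  rw [map_mul]
  nlinarith [norm_nonneg' a, norm_pos' hb]

open Classical in
noncomputable instance instEuc : EuclideanDomain Eis :=
  { (inferInstance : CommRing Eis), (inferInstance : Nontrivial Eis) with
    quotient := fun x y => if h : y = 0 then 0 else (exists_div x y h).choose
    remainder := fun x y => if h : y = 0 then x else x - y * (exists_div x y h).choose
    quotient_zero := fun x => by simp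
    quotient_mul_add_remainder_eq := fun x y => by
      by_cases h : y = 0 <;> simp [h]
    r := fun a b => (norm a).natAbs < (norm b).natAbs
    r_wellFounded := (measure (fun z : Eis => (norm z).natAbs)).wf
    remainder_lt := fun x y h => by
      simp only [h, dite_false]
      have := (exists_div x y h).choose_spec
      have h0 := norm_nonneg' (x - y * (exists_div x y h).choose)
      omega
    mul_left_not_lt := fun a b hb => by
      have := norm_le_mul a hb
      have h0 := norm_nonneg' a
      omega }

instance instPID : IsPrincipalIdealRing Eis := EuclideanDomain.to_principal_ideal_domain
instance instDom : IsDomain Eis := inferInstance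

theorem unit_cases_s11 {u : Eis} (hu : IsUnit u) :
    u = ⟨1, 0⟩ ∨ u = ⟨-1, 0⟩ ∨ u = ⟨0, 1⟩ ∨ u = ⟨0, -1⟩ ∨ u = ⟨1, 1⟩ ∨ u = ⟨-1, -1⟩ := by
  have h := isUnit_iff_norm_isUnit.mp hu
  have h0 := norm_nonneg' u
  have h1 : norm u = 1 := by
    rcases Int.isUnit_iff.mp h with h | h <;> omega
  obtain ⟨a, b⟩ := u
  rw [norm_eq_s11] at h1
  simp only at h1
  have ha : a ≤ 1 := by nlinarith [sq_nonneg (a - 2 * b)]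
  have ha' : -1 ≤ a := by nlinarith [sq_nonneg (a - 2 * b)]
  have hb : b ≤ 1 := by nlinarith [sq_nonneg (b - 2 * a)]
  have hb' : -1 ≤ b := by nlinarith [sq_nonneg (b - 2 * a)]
  interval_cases a <;> interval_cases b <;> simp_all

theorem cube_lemma (M L n : ℤ) (hc : IsCoprime M L) (h3 : ¬ (3 : ℤ) ∣ n)
    (hN : M ^ 2 - M * L + L ^ 2 = n ^ 3) :
    ∃ a b : ℤ, n = a ^ 2 - a * b + b ^ 2 ∧
      ((M = a ^ 3 + b ^ 3 - 3 * a * b ^ 2 ∧ L = 3 * a ^ 2 * b - 3 * a * b ^ 2) ∨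
       (M = -(3 * a ^ 2 * b - 3 * a * b ^ 2) ∧
          L = a ^ 3 + b ^ 3 - 3 * a * b ^ 2 - (3 * a ^ 2 * b - 3 * a * b ^ 2)) ∨
       (M = (3 * a ^ 2 * b - 3 * a * b ^ 2) - (a ^ 3 + b ^ 3 - 3 * a * b ^ 2) ∧
          L = - (a ^ 3 + b ^ 3 - 3 * a * b ^ 2))) := by
  obtain ⟨s, t, hst⟩ := hc
  have h3' : IsCoprime (3 : ℤ) (n ^ 3) :=
    ((Int.prime_three.coprime_iff_not_dvd).mpr h3).pow_right
  obtain ⟨c, d, hcd⟩ := h3'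
  set β : Eis := ⟨M, L⟩ with hβ
  set β' : Eis := ⟨M - L, -L⟩ with hβ'
  have hmul : β * β' = (⟨n, 0⟩ : Eis) ^ 3 := by
    have : (⟨n, 0⟩ : Eis) ^ 3 = ⟨n ^ 3, 0⟩ := by
      ext <;> simp [pow_succ]
    rw [this, ← hN]
    ext <;> simp [hβ, hβ'] <;> ring
  have hcop : IsCoprime β β' := by
    have e1 : (⟨3 * L, 0⟩ : Eis) = (-⟨1, 2⟩) * β + ⟨1, 2⟩ * β' := by
      ext <;> simp [hβ, hβ'] <;> ring
    have e2 : (⟨3 * M, 0⟩ : Eis) = (⟨1, 2⟩ * ⟨-1, -1⟩) * β + (-(⟨1, 2⟩ * ⟨0, 1⟩)) * β' := by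
      ext <;> simp [hβ, hβ'] <;> ring
    have e3 : (1 : Eis) = ⟨c * s, 0⟩ * ⟨3 * M, 0⟩ + ⟨c * t, 0⟩ * ⟨3 * L, 0⟩ + ⟨d, 0⟩ * (β * β') := by
      ext
      · simp [hβ, hβ']
        linear_combination -hcd - 3 * c * hst + d * (-hN)
      · simp [hβ, hβ']; ring_nf; simp
    rw [e1, e2] at e3
    refine ⟨⟨c * s, 0⟩ * (⟨1, 2⟩ * ⟨-1, -1⟩) + ⟨c * t, 0⟩ * (-⟨1, 2⟩) + ⟨d, 0⟩ * β',
      ⟨c * s, 0⟩ * (-(⟨1, 2⟩ * ⟨0, 1⟩)) + ⟨c * t, 0⟩ * ⟨1, 2⟩, ?_⟩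
    conv_rhs => rw [e3]
    ring
  obtain ⟨γ, u, hu⟩ := exists_associated_pow_of_mul_eq_pow' hcop hmul
  have hnorm : norm β = norm γ ^ 3 := by
    rw [← hu, map_mul, map_pow]
    have h := isUnit_iff_norm_isUnit.mp u.isUnit
    have h0 := norm_nonneg' (u : Eis)
    have h1 : norm (u : Eis) = 1 := by
      rcases Int.isUnit_iff.mp h with h | h <;> omega
    rw [h1, mul_one]
  have hn : n = norm γ := by
    have : n ^ 3 = norm γ ^ 3 := by
      rw [← hnorm, ← hN, norm_eq_s11]
    exact (Odd.strictMono_pow (by decide : Odd 3)).injective this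
  rw [norm_eq_s11] at hn
  obtain ⟨a, b⟩ := γ
  simp only at hn
  have hre := congrArg QuadraticAlgebra.re hu
  have him := congrArg QuadraticAlgebra.im hu
  rcases unit_cases_s11 u.isUnit with h | h | h | h | h | h <;> rw [h] at hre him <;>
    simp [hβ, pow_succ] at hre him
  · exact ⟨a, b, by rw [hn], Or.inl ⟨by rw [← hre]; ring, by rw [← him]; ring⟩⟩
  · exact ⟨-a, -b, by rw [hn]; ring, Or.inl ⟨by rw [← hre]; ring, by rw [← him]; ring⟩⟩
  · exact ⟨a, b, by rw [hn], Or.inr (Or.inl ⟨by rw [← hre]; ring, by rw [← him]; ring⟩)⟩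
  · exact ⟨-a, -b, by rw [hn]; ring, Or.inr (Or.inl ⟨by rw [← hre]; ring, by rw [← him]; ring⟩)⟩
  · exact ⟨-a, -b, by rw [hn]; ring, Or.inr (Or.inr ⟨by rw [← hre]; ring, by rw [← him]; ring⟩)⟩
  · exact ⟨a, b, by rw [hn], Or.inr (Or.inr ⟨by rw [← hre]; ring, by rw [← him]; ring⟩)⟩

end Eis

theorem sqf_dvd {c q z : ℤ} (hc : Squarefree c) (hq : Prime q) (h : q ^ 2 ∣ c * z ^ 3) : q ∣ z := by
  by_contra hz
  have h1 : IsCoprime (q ^ 2) (z ^ 3) := (hq.coprime_iff_not_dvd.mpr hz).pow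
  have h2 := h1.dvd_of_dvd_mul_right h
  rw [pow_two] at h2
  exact hq.not_isUnit (hc q h2)

theorem sqf46 : Squarefree (46 : ℤ) := by
  rw [← Int.squarefree_natAbs]
  show Squarefree 46
  rw [Nat.squarefree_iff_nodup_primeFactorsList (by norm_num)]
  simp

theorem sqf2 : Squarefree (2 : ℤ) := Int.prime_two.squarefree

theorem inert2 (M L : ℤ) (h : (2 : ℤ) ∣ M ^ 2 - M * L + L ^ 2) : (2 : ℤ) ∣ M ∧ (2 : ℤ) ∣ L := by
  have key : ∀ a b : ZMod 2, a ^ 2 - a * b + b ^ 2 = 0 → a = 0 ∧ b = 0 := by decide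
  have := key M L (by exact_mod_cast (ZMod.intCast_zmod_eq_zero_iff_dvd _ 2).mpr h)
  exact ⟨(ZMod.intCast_zmod_eq_zero_iff_dvd _ 2).mp this.1,
    (ZMod.intCast_zmod_eq_zero_iff_dvd _ 2).mp this.2⟩

set_option maxRecDepth 10000 in
theorem inert23_s11 (M L : ℤ) (h : (23 : ℤ) ∣ M ^ 2 - M * L + L ^ 2) :
    (23 : ℤ) ∣ M ∧ (23 : ℤ) ∣ L := by
  have key : ∀ a b : ZMod 23, a ^ 2 - a * b + b ^ 2 = 0 → a = 0 ∧ b = 0 := by decide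
  have := key M L (by exact_mod_cast (ZMod.intCast_zmod_eq_zero_iff_dvd _ 23).mpr h)
  exact ⟨(ZMod.intCast_zmod_eq_zero_iff_dvd _ 23).mp this.1,
    (ZMod.intCast_zmod_eq_zero_iff_dvd _ 23).mp this.2⟩

theorem prime23 : Prime (23 : ℤ) := by
  rw [Int.prime_iff_natAbs_prime]; norm_num

theorem core (M L p v : ℤ) (hc : IsCoprime M L) (h3 : ¬ (3 : ℤ) ∣ M ^ 2 - M * L + L ^ 2)
    (hp : p * (M ^ 2 - M * L + L ^ 2) = -46 * v ^ 3)
    (hq : ∀ q : ℤ, Prime q → q ∣ p → q ∣ v → q ∣ M ^ 2 - M * L + L ^ 2 → False) :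
    ∃ e a b : ℤ, p = 46 * e ^ 3 ∧ v = - (e * (a ^ 2 - a * b + b ^ 2)) ∧
      ((M = a ^ 3 + b ^ 3 - 3 * a * b ^ 2 ∧ L = 3 * a ^ 2 * b - 3 * a * b ^ 2) ∨
       (M = -(3 * a ^ 2 * b - 3 * a * b ^ 2) ∧
          L = a ^ 3 + b ^ 3 - 3 * a * b ^ 2 - (3 * a ^ 2 * b - 3 * a * b ^ 2)) ∨
       (M = (3 * a ^ 2 * b - 3 * a * b ^ 2) - (a ^ 3 + b ^ 3 - 3 * a * b ^ 2) ∧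
          L = - (a ^ 3 + b ^ 3 - 3 * a * b ^ 2))) := by
  have n2 : ¬ (2 : ℤ) ∣ M ^ 2 - M * L + L ^ 2 := fun h =>
    Int.prime_two.not_isUnit (hc.isUnit_of_dvd' (inert2 M L h).1 (inert2 M L h).2)
  have n23 : ¬ (23 : ℤ) ∣ M ^ 2 - M * L + L ^ 2 := fun h =>
    prime23.not_isUnit (hc.isUnit_of_dvd' (inert23_s11 M L h).1 (inert23_s11 M L h).2)
  have c46 : IsCoprime (46 : ℤ) (M ^ 2 - M * L + L ^ 2) := by
    have : (46 : ℤ) = 2 * 23 := by norm_num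
    rw [this]
    exact (Int.prime_two.coprime_iff_not_dvd.mpr n2).mul_left
      (prime23.coprime_iff_not_dvd.mpr n23)
  have hN0 : M ^ 2 - M * L + L ^ 2 ≠ 0 := fun h => h3 (by rw [h]; exact dvd_zero _)
  have cpN : IsCoprime p (M ^ 2 - M * L + L ^ 2) := by
    apply isCoprime_of_prime_dvd
    · exact fun h => hN0 h.2
    · intro q hqp h1 h2
      have h4 : q ∣ 46 * v ^ 3 := by
        have : q ∣ -46 * v ^ 3 := hp ▸ (h1.mul_right _)
        rwa [neg_mul, dvd_neg] at this
      rcases hqp.dvd_or_dvd h4 with h | h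
      · exact hqp.not_isUnit (c46.isUnit_of_dvd' h h2)
      · exact hq q hqp h1 (hqp.dvd_of_dvd_pow h) h2
  have d46 : (46 : ℤ) ∣ p := by
    apply c46.dvd_of_dvd_mul_right
    rw [hp]
    exact ⟨-v ^ 3, by ring⟩
  obtain ⟨p', rfl⟩ := d46
  have hp' : p' * (M ^ 2 - M * L + L ^ 2) = (-v) ^ 3 := by
    have : (46 : ℤ) * (p' * (M ^ 2 - M * L + L ^ 2)) = 46 * (-v) ^ 3 := by linear_combination hp
    exact mul_left_cancel₀ (by norm_num) this
  have cp' : IsCoprime p' (M ^ 2 - M * L + L ^ 2) := IsCoprime.of_mul_left_right cpN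
  obtain ⟨e, rfl⟩ := Int.eq_pow_of_mul_eq_pow_odd_left cp' (by decide : Odd 3) hp'
  obtain ⟨n, hn⟩ := Int.eq_pow_of_mul_eq_pow_odd_right cp' (by decide : Odd 3) hp'
  have hv : e * n = -v := by
    rw [hn, ← mul_pow] at hp'
    exact (Odd.strictMono_pow (by decide : Odd 3)).injective hp'
  have h3n : ¬ (3 : ℤ) ∣ n := fun h => h3 (by rw [hn]; exact dvd_pow h (by norm_num))
  obtain ⟨a, b, hab, h⟩ := Eis.cube_lemma M L n hc h3n hn
  exact ⟨e, a, b, rfl, by rw [← hab]; linarith, h⟩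

theorem abs_le_of_eq (e n z c : ℤ) (hz : z ≠ 0) (h : z = c * (e * n)) : |e| ≤ |z| := by
  rw [h, abs_mul, abs_mul]
  have hc : 1 ≤ |c| := Int.one_le_abs (by rintro rfl; simp at h; exact hz h)
  have hn : 1 ≤ |n| := Int.one_le_abs (by rintro rfl; simp at h; exact hz h)
  nlinarith [abs_nonneg e, mul_nonneg (abs_nonneg e) (abs_nonneg n)]

theorem step1 (x y z : ℤ) (hz : z ≠ 0) (hc : IsCoprime x z)
    (h : x ^ 3 + y ^ 3 + 2 * z ^ 3 = 2 * x * y * z) :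
    ∃ T1 T2 T3 e : ℤ, T1 * T2 * T3 = 2 * e ^ 3 ∧ T1 + T2 + T3 = 2 * e ∧ e ≠ 0 ∧ |e| ≤ |z| := by
  by_cases h3 : (3 : ℤ) ∣ z
  · -- case B
    have hx3 : ¬ (3 : ℤ) ∣ x := fun hx => Int.prime_three.not_isUnit (hc.isUnit_of_dvd' hx h3)
    obtain ⟨w, rfl⟩ := h3
    have hxy : (3 : ℤ) ∣ x + y := by
      have : (3 : ℤ) ∣ (x + y) ^ 3 :=
        ⟨2 * x * y * w - 18 * w ^ 3 + x ^ 2 * y + x * y ^ 2, by linear_combination h⟩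
      exact Int.prime_three.dvd_of_dvd_pow this
    obtain ⟨k, hk⟩ := hxy
    obtain rfl : y = 3 * k - x := by linarith
    have hw : (3 : ℤ) ∣ w := by
      have : (3 : ℤ) ∣ x * x * w :=
        ⟨x ^ 2 * w + 3 * k ^ 3 - 3 * k ^ 2 * x + k * x ^ 2 + 6 * w ^ 3 - 2 * x * k * w,
          by linarith [h]⟩
      rcases Int.prime_three.dvd_or_dvd this with h' | h'
      · rcases Int.prime_three.dvd_or_dvd h' with h' | h' <;> exact absurd h' hx3
      · exact h'
    obtain ⟨v, rfl⟩ := hw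
    have hkv : (3 : ℤ) ∣ k + 2 * v := by
      have : (3 : ℤ) ∣ x * x * (k + 2 * v) :=
        ⟨2 * x * k * v - 54 * v ^ 3 - k * k * k + x * k * k, by linarith [h]⟩
      rcases Int.prime_three.dvd_or_dvd this with h' | h'
      · rcases Int.prime_three.dvd_or_dvd h' with h' | h' <;> exact absurd h' hx3
      · exact h'
    obtain ⟨p, hp⟩ := hkv
    obtain rfl : k = 3 * p - 2 * v := by linarith
    -- M = x - 3p, L = 3p - 6v
    have hv0 : v ≠ 0 := by rintro rfl; simp at hz
    have hpN : p * ((x - 3 * p) ^ 2 - (x - 3 * p) * (3 * p - 6 * v) + (3 * p - 6 * v) ^ 2) =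
        -46 * v ^ 3 := by linarith [h]
    have hML : IsCoprime (x - 3 * p) (3 * p - 6 * v) := by
      apply isCoprime_of_prime_dvd
      · rintro ⟨h1, h2⟩
        exact hx3 ⟨p, by linarith⟩
      · intro q hq h1 h2
        have hqv : q ∣ v := by
          apply sqf_dvd sqf46 hq
          have : q ^ 2 ∣ p * ((x - 3 * p) ^ 2 - (x - 3 * p) * (3 * p - 6 * v) +
              (3 * p - 6 * v) ^ 2) := by
            obtain ⟨r, hr⟩ := h1
            obtain ⟨s, hs⟩ := h2
            rw [hr, hs]
            exact ⟨p * (r ^ 2 - r * s + s ^ 2), by ring⟩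
          rw [hpN, neg_mul, dvd_neg] at this
          exact this
        have h3p : q ∣ 3 * p := by
          have := dvd_add h2 (hqv.mul_left 6)
          simpa using this
        have hqx : q ∣ x := by
          have := dvd_add h1 h3p
          simpa using this
        exact hq.not_isUnit (hc.isUnit_of_dvd' hqx ((hqv.mul_left 3).mul_left 3))
    have hN3 : ¬ (3 : ℤ) ∣ (x - 3 * p) ^ 2 - (x - 3 * p) * (3 * p - 6 * v) +
        (3 * p - 6 * v) ^ 2 := by
      rintro ⟨r, hr⟩
      apply hx3
      apply Int.prime_three.dvd_of_dvd_pow (n := 2)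
      exact ⟨r + 2 * x * p - 3 * p ^ 2 + (x - 3 * p) * (p - 2 * v) - 3 * (p - 2 * v) ^ 2,
        by linarith [hr]⟩
    obtain ⟨e, a, b, hpe, hve, hcase⟩ := core _ _ _ _ hML hN3 hpN (by
      intro q hq h1 h2 h4
      have hL : q ∣ 3 * p - 6 * v := dvd_sub (h1.mul_left 3) (h2.mul_left 6)
      have hM : q ∣ (x - 3 * p) ^ 2 := by
        have : (x - 3 * p) ^ 2 = ((x - 3 * p) ^ 2 - (x - 3 * p) * (3 * p - 6 * v) +
          (3 * p - 6 * v) ^ 2) + (3 * p - 6 * v) * ((x - 3 * p) - (3 * p - 6 * v)) := by ring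
        rw [this]
        exact dvd_add h4 (hL.mul_right _)
      exact hq.not_isUnit (hML.isUnit_of_dvd' (hq.dvd_of_dvd_pow hM) hL))
    have he0 : e ≠ 0 := by rintro rfl; simp at hve; exact hv0 hve
    have hM3 : ∀ t, x - 3 * p ≠ 3 * t := fun t ht => hx3 ⟨p + t, by linarith⟩
    rcases hcase with ⟨hM, hL⟩ | ⟨hM, hL⟩ | ⟨hM, hL⟩
    · refine ⟨2 * e - b, 2 * e + a, 2 * e + b - a, 3 * e, ?_, by ring, by simpa using he0, ?_⟩
      · rw [hpe, hve] at hL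
        linarith [hL]
      · apply abs_le_of_eq (3 * e) (a ^ 2 - a * b + b ^ 2) _ (-3) hz
        rw [hve]; ring
    · exact absurd (hM.trans (by ring)) (hM3 (-(a ^ 2 * b - a * b ^ 2)))
    · exfalso
      apply hM3 ((a ^ 2 * b - a * b ^ 2) + (p - 2 * v))
      linarith
  · -- case A
    have hpN : (3 * x + 3 * y + 2 * z) * ((3 * x - 2 * z) ^ 2 - (3 * x - 2 * z) * (3 * y - 2 * z) +
        (3 * y - 2 * z) ^ 2) = -46 * z ^ 3 := by linear_combination 27 * h
    have hN3 : ¬ (3 : ℤ) ∣ (3 * x - 2 * z) ^ 2 - (3 * x - 2 * z) * (3 * y - 2 * z) +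
        (3 * y - 2 * z) ^ 2 := by
      rintro ⟨r, hr⟩
      apply h3
      apply Int.prime_three.dvd_of_dvd_pow (n := 2)
      exact ⟨r - (3 * x ^ 2 - 3 * x * y + 3 * y ^ 2 - 2 * x * z - 2 * y * z) - z ^ 2,
        by linarith [hr]⟩
    have hML : IsCoprime (3 * x - 2 * z) (3 * y - 2 * z) := by
      apply isCoprime_of_prime_dvd
      · rintro ⟨h1, h2⟩
        exact h3 ⟨z - x, by linarith⟩
      · intro q hq h1 h2
        have hqv : q ∣ z := by
          apply sqf_dvd sqf46 hq
          have : q ^ 2 ∣ (3 * x + 3 * y + 2 * z) * ((3 * x - 2 * z) ^ 2 -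
              (3 * x - 2 * z) * (3 * y - 2 * z) + (3 * y - 2 * z) ^ 2) := by
            obtain ⟨r, hr⟩ := h1
            obtain ⟨s, hs⟩ := h2
            rw [hr, hs]
            exact ⟨(3 * x + 3 * y + 2 * z) * (r ^ 2 - r * s + s ^ 2), by ring⟩
          rw [hpN, neg_mul, dvd_neg] at this
          exact this
        have h3x : q ∣ 3 * x := by
          have := dvd_add h1 (hqv.mul_left 2)
          simpa using this
        rcases hq.dvd_or_dvd h3x with h' | h'
        · have := hq.associated_of_dvd Int.prime_three h'
          exact h3 (this.symm.dvd.trans hqv)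
        · exact hq.not_isUnit (hc.isUnit_of_dvd' h' hqv)
    obtain ⟨e, a, b, hpe, hve, hcase⟩ := core _ _ _ _ hML hN3 hpN (by
      intro q hq h1 h2 h4
      have hS : q ∣ (3 * x - 2 * z) + (3 * y - 2 * z) := by
        have := dvd_sub h1 (h2.mul_left 6)
        have e : (3 * x - 2 * z) + (3 * y - 2 * z) = 3 * x + 3 * y + 2 * z - 6 * z := by ring
        rwa [e]
      have hP : q ∣ 3 * (3 * x - 2 * z) ^ 2 := by
        have : 3 * (3 * x - 2 * z) ^ 2 = ((3 * x - 2 * z) ^ 2 - (3 * x - 2 * z) * (3 * y - 2 * z) +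
          (3 * y - 2 * z) ^ 2) + ((3 * x - 2 * z) + (3 * y - 2 * z)) *
            (2 * (3 * x - 2 * z) - (3 * y - 2 * z)) := by ring
        rw [this]
        exact dvd_add h4 (hS.mul_right _)
      rcases hq.dvd_or_dvd hP with h' | h'
      · have := hq.associated_of_dvd Int.prime_three h'
        exact h3 (this.symm.dvd.trans h2)
      · have hM := hq.dvd_of_dvd_pow h'
        exact hq.not_isUnit (hML.isUnit_of_dvd' hM ((dvd_add_right hM).mp hS)))
    have he0 : e ≠ 0 := by rintro rfl; simp at hve; exact hz hve
    have hz3 : ∀ t, z ≠ 3 * t := fun t ht => h3 ⟨t, ht⟩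
    rcases hcase with ⟨hM, hL⟩ | ⟨hM, hL⟩ | ⟨hM, hL⟩
    · exfalso
      apply hz3 (a ^ 2 * b - a * b ^ 2 - y + z)
      linarith
    · exfalso
      apply hz3 (-(a ^ 2 * b - a * b ^ 2) - x + z)
      linarith
    · have hsum : -2 * a ^ 3 - 2 * b ^ 3 + 3 * a ^ 2 * b + 3 * a * b ^ 2 =
          46 * e ^ 3 + 6 * e * (a ^ 2 - a * b + b ^ 2) := by
        have : (3 * x - 2 * z) + (3 * y - 2 * z) = (3 * x + 3 * y + 2 * z) - 6 * z := by ring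
        rw [hM, hL, hpe, hve] at this
        linear_combination this
      have h3e : (3 : ℤ) ∣ 2 * e + a + b := by
        have key : ∀ a b e : ZMod 3, -2 * a ^ 3 - 2 * b ^ 3 + 3 * a ^ 2 * b + 3 * a * b ^ 2 =
          46 * e ^ 3 + 6 * e * (a ^ 2 - a * b + b ^ 2) → 2 * e + a + b = 0 := by decide
        have := key a b e (by exact_mod_cast congrArg (Int.cast : ℤ → ZMod 3) hsum)
        exact (ZMod.intCast_zmod_eq_zero_iff_dvd _ 3).mp (by exact_mod_cast this)
      obtain ⟨T, hT⟩ := h3e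
      refine ⟨T, T - b, T - a, e, ?_, by linarith, he0, ?_⟩
      · obtain rfl : b = 3 * T - 2 * e - a := by linarith
        linarith [hsum]
      · apply abs_le_of_eq e (a ^ 2 - a * b + b ^ 2) _ (-1) hz
        rw [hve]; ring

theorem step2a (a T2 T3 e : ℤ) (he : e ≠ 0) (h : 2 * a * T2 * T3 = 2 * e ^ 3)
    (hs : 2 * a + T2 + T3 = 2 * e) (c12 : IsCoprime (2 * a) T2) (c13 : IsCoprime (2 * a) T3)
    (c23 : IsCoprime T2 T3) :
    ∃ x y z : ℤ, z ≠ 0 ∧ IsCoprime x z ∧ x ^ 3 + y ^ 3 + 2 * z ^ 3 = 2 * x * y * z ∧ |z| < |e| := by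
  have c12' : IsCoprime a T2 := c12.of_mul_left_right
  have c13' : IsCoprime a T3 := c13.of_mul_left_right
  have h' : a * (T2 * T3) = e ^ 3 := by linarith
  have h'' : T2 * (a * T3) = e ^ 3 := by linarith
  have h''' : T3 * (a * T2) = e ^ 3 := by linarith
  obtain ⟨z, rfl⟩ := Int.eq_pow_of_mul_eq_pow_odd_left (c12'.mul_right c13') (by decide : Odd 3) h'
  obtain ⟨x, rfl⟩ := Int.eq_pow_of_mul_eq_pow_odd_left (c12'.symm.mul_right c23)
    (by decide : Odd 3) h''
  obtain ⟨y, rfl⟩ := Int.eq_pow_of_mul_eq_pow_odd_left (c13'.symm.mul_right c23.symm)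
    (by decide : Odd 3) h'''
  have hexyz : e = x * y * z := by
    refine (Odd.strictMono_pow (by decide : Odd 3)).injective (a₁ := e) (a₂ := x * y * z) ?_
    show e ^ 3 = (x * y * z) ^ 3
    rw [← h']; ring
  subst hexyz
  have hx : x ≠ 0 := by rintro rfl; simp at he
  have hy : y ≠ 0 := by rintro rfl; simp at he
  have hz : z ≠ 0 := by rintro rfl; simp at he
  refine ⟨x, y, z, hz, ?_, by linarith, ?_⟩
  · exact ((IsCoprime.pow_iff (by norm_num) (by norm_num)).mp c12').symm
  · rw [abs_mul, abs_mul]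
    have hx1 := Int.one_le_abs hx
    have hy1 := Int.one_le_abs hy
    have hz1 := Int.one_le_abs hz
    by_contra hlt
    push Not at hlt
    have hxy : |x| * |y| ≤ 1 := by
      by_contra hh
      push Not at hh
      nlinarith
    have hx2 : |x| = 1 := by nlinarith
    have hy2 : |y| = 1 := by nlinarith
    have hcon : ∀ t : ℤ, t ^ 3 - t ≠ 1 ∧ t ^ 3 - t ≠ -1 := by
      intro t
      have key : ∀ t : ZMod 2, t ^ 3 - t = 0 := by decide
      have h2 : (2 : ℤ) ∣ t ^ 3 - t :=
        (ZMod.intCast_zmod_eq_zero_iff_dvd _ 2).mp (by exact_mod_cast key t)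
      omega
    rcases (abs_eq (by norm_num : (0 : ℤ) ≤ 1)).mp hx2 with rfl | rfl <;>
    rcases (abs_eq (by norm_num : (0 : ℤ) ≤ 1)).mp hy2 with rfl | rfl
    · exact (hcon z).2 (by linarith)
    · have : z * (z ^ 2 + 1) = 0 := by linarith
      rcases mul_eq_zero.mp this with h | h
      · exact hz h
      · nlinarith [sq_nonneg z]
    · have : z * (z ^ 2 + 1) = 0 := by linarith
      rcases mul_eq_zero.mp this with h | h
      · exact hz h
      · nlinarith [sq_nonneg z]
    · exact (hcon z).1 (by linarith)

theorem step2b (T1 T2 T3 e : ℤ) (he : e ≠ 0) (h : T1 * T2 * T3 = 2 * e ^ 3)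
    (hs : T1 + T2 + T3 = 2 * e)
    (hprim : ∀ q : ℤ, Prime q → q ∣ T1 → q ∣ T2 → q ∣ T3 → q ∣ e → False) :
    ∃ x y z : ℤ, z ≠ 0 ∧ IsCoprime x z ∧ x ^ 3 + y ^ 3 + 2 * z ^ 3 = 2 * x * y * z ∧ |z| < |e| := by
  have hne : T1 * T2 * T3 ≠ 0 := by rw [h]; positivity
  have h1 : T1 ≠ 0 := by rintro rfl; simp at hne
  have h2 : T2 ≠ 0 := by rintro rfl; simp at hne
  have h3 : T3 ≠ 0 := by rintro rfl; simp at hne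
  have gen : ∀ A B C : ℤ, A ≠ 0 → A * B * C = 2 * e ^ 3 → A + B + C = 2 * e →
      (∀ q : ℤ, Prime q → q ∣ A → q ∣ B → q ∣ C → q ∣ e → False) → IsCoprime A B := by
    intro A B C hA hm hsum hq
    apply isCoprime_of_prime_dvd
    · exact fun h => hA h.1
    · intro q hqp hqA hqB
      have hqe : q ∣ e := by
        apply sqf_dvd sqf2 hqp
        rw [← hm, pow_two]
        exact (mul_dvd_mul hqA hqB).mul_right _
      refine hq q hqp hqA hqB ?_ hqe
      have : C = 2 * e - A - B := by linarith
      rw [this]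
      exact dvd_sub (dvd_sub (hqe.mul_left 2) hqA) hqB
  have c12 := gen T1 T2 T3 h1 h hs hprim
  have c13 := gen T1 T3 T2 h1 (by linarith) (by linarith)
    (fun q hq a b c d => hprim q hq a c b d)
  have c23 := gen T2 T3 T1 h2 (by linarith) (by linarith)
    (fun q hq a b c d => hprim q hq c a b d)
  have h2d : (2 : ℤ) ∣ T1 * T2 * T3 := ⟨e ^ 3, h⟩
  rcases Int.prime_two.dvd_or_dvd h2d with hh | hh
  · rcases Int.prime_two.dvd_or_dvd hh with hh | hh
    · obtain ⟨a, rfl⟩ := hh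
      exact step2a a T2 T3 e he h hs c12 c13 c23
    · obtain ⟨a, rfl⟩ := hh
      exact step2a a T1 T3 e he (by linarith) (by linarith) c12.symm c23 c13
  · obtain ⟨a, rfl⟩ := hh
    exact step2a a T1 T2 e he (by linarith) (by linarith) c13.symm c23.symm c12

theorem step2 (n : ℕ) : ∀ (T1 T2 T3 e : ℤ), e.natAbs = n → e ≠ 0 → T1 * T2 * T3 = 2 * e ^ 3 →
    T1 + T2 + T3 = 2 * e →
    ∃ x y z : ℤ, z ≠ 0 ∧ IsCoprime x z ∧ x ^ 3 + y ^ 3 + 2 * z ^ 3 = 2 * x * y * z ∧ |z| < |e| := by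
  induction n using Nat.strong_induction_on with
  | _ n ih =>
    intro T1 T2 T3 e hn he h hs
    by_cases hprim : ∀ q : ℤ, Prime q → q ∣ T1 → q ∣ T2 → q ∣ T3 → q ∣ e → False
    · exact step2b T1 T2 T3 e he h hs hprim
    · push Not at hprim
      obtain ⟨q, hq, ⟨t1, rfl⟩, ⟨t2, rfl⟩, ⟨t3, rfl⟩, ⟨f, rfl⟩, -⟩ := hprim
      have hf : f ≠ 0 := by rintro rfl; simp at he
      have hq1 : 1 < q.natAbs := (Int.prime_iff_natAbs_prime.mp hq).one_lt
      have hfpos : 0 < f.natAbs := Int.natAbs_pos.mpr hf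
      have hlt : f.natAbs < n := by
        rw [← hn, Int.natAbs_mul]; nlinarith
      obtain ⟨x, y, z, hz, hc, heq, hzf⟩ := ih _ hlt t1 t2 t3 f rfl hf
        (mul_left_cancel₀ (pow_ne_zero 3 hq.ne_zero) (by linear_combination h))
        (mul_left_cancel₀ hq.ne_zero (by linear_combination hs))
      refine ⟨x, y, z, hz, hc, heq, ?_⟩
      rw [abs_mul]
      have : 1 ≤ |q| := Int.one_le_abs hq.ne_zero
      nlinarith [abs_nonneg f]

theorem no_sol (n : ℕ) : ∀ (x y z : ℤ), z.natAbs = n → z ≠ 0 → IsCoprime x z →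
    x ^ 3 + y ^ 3 + 2 * z ^ 3 = 2 * x * y * z → False := by
  induction n using Nat.strong_induction_on with
  | _ n ih =>
    intro x y z hn hz hc h
    obtain ⟨T1, T2, T3, e, hm, hs, he, hle⟩ := step1 x y z hz hc h
    obtain ⟨x', y', z', hz', hc', h', hlt⟩ := step2 _ T1 T2 T3 e rfl he hm hs
    exact ih z'.natAbs (by zify [← hn]; omega) x' y' z' rfl hz' hc' h'

theorem no_D (T1 T2 T3 e : ℤ) (h : T1 * T2 * T3 = 2 * e ^ 3) (hs : T1 + T2 + T3 = 2 * e) :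
    e = 0 := by
  by_contra he
  obtain ⟨x', y', z', hz', hc', h', -⟩ := step2 _ T1 T2 T3 e rfl he h hs
  exact no_sol _ x' y' z' rfl hz' hc' h'

theorem stmt_11 (x y : ℚ) :
    y ^ 2 = x ^ 3 - 2 * x ^ 2 + 3 * x - 1 ↔ (x = 1 ∧ y = 1) ∨ (x = 1 ∧ y = -1) := by
  constructor
  · intro h
    obtain ⟨u, rfl⟩ : ∃ u, x = u + 1 := ⟨x - 1, by ring⟩
    have hu : u = 0 := by
      have hud : (u.den : ℚ) ≠ 0 := by exact_mod_cast u.den_nz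
      have hyd : (y.den : ℚ) ≠ 0 := by exact_mod_cast y.den_nz
      have e1 : (u.num : ℚ) = u * u.den := (Rat.mul_den_eq_num u).symm
      have e2 : (y.num : ℚ) = y * y.den := (Rat.mul_den_eq_num y).symm
      have := no_D (2 * u.den * y.den) (y.num * u.den - u.num * y.den - u.den * y.den)
        (-(y.num * u.den + u.num * y.den + u.den * y.den)) (-(u.num * y.den))
        (by
          have : ((2 * u.den * y.den : ℤ) * (y.num * u.den - u.num * y.den - u.den * y.den) *
            (-(y.num * u.den + u.num * y.den + u.den * y.den)) : ℚ) =
            2 * (-(u.num * y.den)) ^ 3 := by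
            push_cast
            rw [e1, e2]
            linear_combination (-2 * (u.den : ℚ) ^ 3 * (y.den : ℚ) ^ 3) * h
          exact_mod_cast this)
        (by ring)
      have h0 : u.num * (y.den : ℤ) = 0 := by linarith
      rcases mul_eq_zero.mp h0 with h0 | h0
      · exact Rat.num_eq_zero.mp h0
      · exact absurd h0 (by exact_mod_cast y.den_nz)
    subst hu
    have : (y - 1) * (y + 1) = 0 := by linear_combination h
    rcases mul_eq_zero.mp this with h | h
    · exact Or.inl ⟨by ring, by linarith⟩
    · exact Or.inr ⟨by ring, by linarith⟩
  · rintro (⟨rfl, rfl⟩ | ⟨rfl, rfl⟩) <;> norm_num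
end
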